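/- arXiv:1502.05428 — 12 statements merged into one kernel-verified Lean document; each statement's English description precedes it below -/
import Mathlib

section
/- Let B_1 ≥ B_2 ≥ … ≥ B_M > 0 be real numbers, let ᾱ, β̄ ∈ ℝ^M with α_m ≠ 0 for all m and Σ_{m=1}^M α_mβ_m = 1, and let Σ_V be the symmetric M×M real matrix with off-diagonal entries Σ_V[j,m] = Σ_V[m,j] = −β_jβ_m B_m for 1 ≤ j < m ≤ M and diagonal entries Σ_V[m,m] = (β_m/α_m)(B_m Σ_{j<m} α_jβ_j + Σ_{j>m} α_jβ_j B_j). If Σ_V is positive semidefinite, then α_mβ_m ≥ 0 for every m = 1,2,…,M. -/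
open Matrix BigOperators Finset

/-- The auxiliary covariance matrix `Σ_V` of the broadcast matching analysis:
off-diagonal entries `Σ_V[j,m] = Σ_V[m,j] = -β_j β_m B_m` for `j < m`, and diagonal entries
`Σ_V[m,m] = (β_m/α_m) (B_m ∑_{j<m} α_j β_j + ∑_{j>m} α_j β_j B_j)`. -/
noncomputable def SigmaV {M : ℕ} (α β B : Fin M → ℝ) : Matrix (Fin M) (Fin M) ℝ :=
  Matrix.of fun i j =>
    if i = j then
      (β i / α i) * (B i * ∑ k ∈ Finset.Iio i, α k * β k +
        ∑ k ∈ Finset.Ioi i, α k * β k * B k)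
    else
      -(β i * β j * B (max i j))

theorem sum_Iic_add_sum_Ioi {M : ℕ} (f : Fin M → ℝ) (i : Fin M) :
    ∑ j ∈ Finset.Iic i, f j + ∑ j ∈ Finset.Ioi i, f j = ∑ j, f j := by
  have h : Finset.Ioi i = (Finset.Iic i)ᶜ := by
    ext j
    simp
  rw [h, Finset.sum_add_sum_compl]

theorem sum_Iio_add_self {M : ℕ} (f : Fin M → ℝ) (i : Fin M) :
    ∑ j ∈ Finset.Iio i, f j + f i = ∑ j ∈ Finset.Iic i, f j := by
  rw [← Finset.Iio_insert i, Finset.sum_insert (by simp), add_comm]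

/-- The vector `α` lies in the kernel of `SigmaV α β B`. -/
theorem SigmaV_row_sum {M : ℕ} (α β B : Fin M → ℝ) (hα : ∀ m, α m ≠ 0) (i : Fin M) :
    ∑ j, SigmaV α β B i j * α j = 0 := by
  rw [← sum_Iic_add_sum_Ioi _ i, ← sum_Iio_add_self]
  have h1 : ∑ j ∈ Finset.Iio i, SigmaV α β B i j * α j =
      -(β i * (B i * ∑ j ∈ Finset.Iio i, α j * β j)) := by
    rw [Finset.mul_sum, Finset.mul_sum, ← Finset.sum_neg_distrib]
    refine Finset.sum_congr rfl fun j hj => ?_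
    have hj' := Finset.mem_Iio.1 hj
    simp only [SigmaV, Matrix.of_apply, if_neg hj'.ne', max_eq_left hj'.le]
    ring
  have h2 : ∑ j ∈ Finset.Ioi i, SigmaV α β B i j * α j =
      -(β i * ∑ j ∈ Finset.Ioi i, α j * β j * B j) := by
    rw [Finset.mul_sum, ← Finset.sum_neg_distrib]
    refine Finset.sum_congr rfl fun j hj => ?_
    have hj' := Finset.mem_Ioi.1 hj
    simp only [SigmaV, Matrix.of_apply, if_neg hj'.ne, max_eq_right hj'.le]
    ring
  rw [h1, h2]
  simp only [SigmaV, Matrix.of_apply, if_true]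
  have := hα i
  field_simp
  ring

/-- The quadratic form of `SigmaV α β B` at the truncation of `α` to the indices `≤ n`. -/
theorem SigmaV_truncation {M : ℕ} (α β B : Fin M → ℝ) (hα : ∀ m, α m ≠ 0) (n : Fin M) :
    ∑ i ∈ Finset.Iic n, α i * ∑ j ∈ Finset.Iic n, SigmaV α β B i j * α j =
      (∑ i ∈ Finset.Iic n, α i * β i) * ∑ j ∈ Finset.Ioi n, α j * β j * B j := by
  rw [Finset.sum_mul]
  refine Finset.sum_congr rfl fun i hi => ?_
  have h := SigmaV_row_sum α β B hα i
  rw [← sum_Iic_add_sum_Ioi _ n] at h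
  have h2 : ∑ j ∈ Finset.Ioi n, SigmaV α β B i j * α j =
      -(β i * ∑ j ∈ Finset.Ioi n, α j * β j * B j) := by
    rw [Finset.mul_sum, ← Finset.sum_neg_distrib]
    refine Finset.sum_congr rfl fun j hj => ?_
    have hij := (Finset.mem_Iic.1 hi).trans_lt (Finset.mem_Ioi.1 hj)
    simp only [SigmaV, Matrix.of_apply, if_neg hij.ne, max_eq_right hij.le]
    ring
  rw [eq_neg_of_add_eq_zero_left h, h2]
  ring

/-- Lemma 1: if `B_1 ≥ … ≥ B_M > 0`, all `α_m ≠ 0`, `∑ α_m β_m = 1`,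
and `Σ_V` is positive semidefinite, then `α_m β_m ≥ 0` for every `m`. -/
theorem stmt_0 {M : ℕ} (hM : 2 ≤ M) (α β B : Fin M → ℝ)
    (hBmono : ∀ i j : Fin M, i ≤ j → B j ≤ B i) (hBpos : ∀ m, 0 < B m)
    (hα : ∀ m, α m ≠ 0) (hsum : ∑ m, α m * β m = 1)
    (hpsd : (SigmaV α β B).PosSemidef) :
    ∀ m, 0 ≤ α m * β m := by
  by_contra! hneg
  obtain ⟨m, hm⟩ := hneg
  obtain ⟨n, hn, hmax⟩ := Finset.exists_max_image
    (Finset.univ.filter fun k => α k * β k < 0) id ⟨m, by simpa using hm⟩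
  have hxn : α n * β n < 0 := by simpa using hn
  have htail : ∀ j ∈ Finset.Ioi n, 0 ≤ α j * β j := by
    intro j hj
    by_contra! h
    exact (hmax j (by simpa using h)).not_gt (Finset.mem_Ioi.1 hj)
  have hR : 0 ≤ ∑ j ∈ Finset.Ioi n, α j * β j * B j :=
    Finset.sum_nonneg fun j hj => mul_nonneg (htail j hj) (hBpos j).le
  have hdiag : 0 ≤ SigmaV α β B n n := hpsd.diag_nonneg
  simp only [SigmaV, Matrix.of_apply, if_true] at hdiag
  have hratio : β n / α n < 0 := by
    rw [div_eq_mul_inv]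
    exact mul_neg_iff.2 ((mul_neg_iff.1 hxn).symm.imp
      (fun h => ⟨h.2, inv_lt_zero.2 h.1⟩) (fun h => ⟨h.2, inv_pos.2 h.1⟩))
  have hle := nonpos_of_mul_nonneg_right hdiag hratio
  have hprefix : ∑ k ∈ Finset.Iio n, α k * β k ≤ 0 := by
    by_contra! h
    have := mul_pos (hBpos n) h
    linarith
  have hX : ∑ k ∈ Finset.Iic n, α k * β k < 0 := by
    rw [← sum_Iio_add_self]
    linarith
  have htailsum : 0 < ∑ k ∈ Finset.Ioi n, α k * β k := by
    rw [← sum_Iic_add_sum_Ioi _ n] at hsum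
    linarith
  obtain ⟨j, hj, hjpos⟩ := Finset.exists_lt_of_sum_lt
    (s := Finset.Ioi n) (f := fun _ => (0 : ℝ)) (g := fun k => α k * β k) (by simpa using htailsum)
  have hRpos : 0 < ∑ j ∈ Finset.Ioi n, α j * β j * B j :=
    Finset.sum_pos' (fun k hk => mul_nonneg (htail k hk) (hBpos k).le)
      ⟨j, hj, mul_pos hjpos (hBpos j)⟩
  have hform := hpsd.dotProduct_mulVec_nonneg (fun i => if i ∈ Finset.Iic n then α i else 0)
  have hcut : 0 ≤ ∑ i ∈ Finset.Iic n, α i * ∑ j ∈ Finset.Iic n, SigmaV α β B i j * α j := by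
    simpa only [dotProduct, Matrix.mulVec, Pi.star_apply, star_trivial, ite_mul, zero_mul,
      mul_ite, mul_zero, Finset.sum_ite_mem, Finset.univ_inter] using hform
  rw [SigmaV_truncation α β B hα n] at hcut
  exact hcut.not_gt (mul_neg_of_neg_of_pos hX hRpos)
end

section
/- The vector ᾱ lies in the kernel of Σ_V, i.e. Σ_V ᾱ = 0; consequently, since Σ_S ᾱ = Pβ̄ and β̄ᵀᾱ = 1, also Σ^{(0)} ᾱ = (Σ_V − Σ_S + Pβ̄β̄ᵀ) ᾱ = 0. -/
open Matrix BigOperators Finset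

theorem sum_univ_eq_sum_Iio_add_add_sum_Ioi {M : ℕ} (i : Fin M) (f : Fin M → ℝ) :
    ∑ j, f j = ∑ j ∈ Finset.Iio i, f j + f i + ∑ j ∈ Finset.Ioi i, f j := by
  have hlt : Finset.univ.filter (· < i) = Finset.Iio i := by ext; simp
  have hgt : Finset.univ.filter (i < ·) = Finset.Ioi i := by ext; simp
  have hi : f i = ∑ j, if j = i then f j else 0 := by simp
  rw [← hlt, ← hgt, Finset.sum_filter, Finset.sum_filter, hi, ← Finset.sum_add_distrib,
    ← Finset.sum_add_distrib]
  refine Finset.sum_congr rfl fun j _ => ?_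
  rcases lt_trichotomy j i with h | h | h
  · simp [h, h.ne, h.not_gt]
  · simp [h]
  · simp [h, h.ne', h.not_gt]

theorem SigmaV_mulVec_eq_zero {M : ℕ} (α β B : Fin M → ℝ) (hα : ∀ m, α m ≠ 0) :
    SigmaV α β B *ᵥ α = 0 := by
  ext i
  have hlt : ∑ j ∈ Finset.Iio i, SigmaV α β B i j * α j =
      -(β i * B i * ∑ j ∈ Finset.Iio i, α j * β j) := by
    rw [Finset.mul_sum, ← Finset.sum_neg_distrib]
    refine Finset.sum_congr rfl fun j hj => ?_
    have h := Finset.mem_Iio.mp hj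
    simp only [SigmaV, Matrix.of_apply, if_neg h.ne', max_eq_left h.le]
    ring
  have hgt : ∑ j ∈ Finset.Ioi i, SigmaV α β B i j * α j =
      -(β i * ∑ j ∈ Finset.Ioi i, α j * β j * B j) := by
    rw [Finset.mul_sum, ← Finset.sum_neg_distrib]
    refine Finset.sum_congr rfl fun j hj => ?_
    have h := Finset.mem_Ioi.mp hj
    simp only [SigmaV, Matrix.of_apply, if_neg h.ne, max_eq_right h.le]
    ring
  have hdiag : SigmaV α β B i i * α i =
      β i * (B i * ∑ j ∈ Finset.Iio i, α j * β j +
        ∑ j ∈ Finset.Ioi i, α j * β j * B j) := by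
    have := hα i
    simp only [SigmaV, Matrix.of_apply, if_true]
    field_simp
  simp only [Matrix.mulVec, dotProduct, Pi.zero_apply]
  rw [sum_univ_eq_sum_Iio_add_add_sum_Ioi i, hlt, hgt, hdiag]
  ring

/-- `Σ_V ᾱ = 0`, and consequently `Σ^{(0)} ᾱ = (Σ_V − Σ_S + P β̄ β̄ᵀ) ᾱ = 0`. -/
theorem stmt_1 {M : ℕ} (hM : 2 ≤ M)
    (SigS : Matrix (Fin M) (Fin M) ℝ) (hS : SigS.PosDef)
    (α : Fin M → ℝ) (hα : ∀ m, α m ≠ 0)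
    (P : ℝ) (hP : P = α ⬝ᵥ (SigS *ᵥ α)) (hPpos : 0 < P)
    (β : Fin M → ℝ) (hβ : β = fun m => (SigS *ᵥ α) m / P)
    (σZ : Fin M → ℝ) (hσmono : ∀ i j : Fin M, i ≤ j → σZ j ≤ σZ i)
    (hσpos : ∀ m, 0 < σZ m)
    (B : Fin M → ℝ) (hB : B = fun m => P * σZ m / (P + σZ m)) :
    (SigmaV α β B) *ᵥ α = 0 ∧
    (SigmaV α β B - SigS + P • vecMulVec β β) *ᵥ α = 0 := by
  have hV := SigmaV_mulVec_eq_zero α β B hα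
  refine ⟨hV, ?_⟩
  have hSα : SigS *ᵥ α = P • β := by
    ext m
    simp only [hβ, Pi.smul_apply, smul_eq_mul]
    field_simp
  have hβα : β ⬝ᵥ α = 1 := by
    rw [hSα, dotProduct_smul, smul_eq_mul, dotProduct_comm] at hP
    exact mul_left_cancel₀ hPpos.ne' (by linarith)
  rw [add_mulVec, sub_mulVec, hV, hSα, smul_mulVec, vecMulVec_mulVec, hβα]
  simp
end

section
/- Let ᾱ, β̄ ∈ ℝ^M with α_m ≠ 0 and α_mβ_m ≥ 0 for all m, let ΔP ≥ 0, and fix an index m* ∈ {1,…,M}. Define the symmetric M×M matrix D whose only nonzero entries are D[i,i] = (β_i/α_i)α_{m*}β_{m*}ΔP for i < m*, D[i,m*] = D[m*,i] = −β_iβ_{m*}ΔP for i < m*, and D[m*,m*] = (β_{m*}/α_{m*})ΔP Σ_{i<m*} α_iβ_i. Then D is positive semidefinite. -/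
open Matrix BigOperators Finset

/-- The increment vector comparing coordinate `k` with coordinate `m`, each rescaled by `α`. -/
noncomputable def scaledDiff {ι : Type*} [DecidableEq ι] (α : ι → ℝ) (m k i : ι) : ℝ :=
  (if i = k then (α k)⁻¹ else 0) - (if i = m then (α m)⁻¹ else 0)

/-- the increment matrix `D` obtained when a single noise power is increased
(by `ΔP` in terms of `B_{m*}`) is positive semidefinite, provided `α_m β_m ≥ 0` for all `m`
and `ΔP ≥ 0`. -/
theorem stmt_2 {M : ℕ} (hM : 2 ≤ M) (α β : Fin M → ℝ) (hα : ∀ m, α m ≠ 0)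
    (hαβ : ∀ m, 0 ≤ α m * β m) (ΔP : ℝ) (hΔP : 0 ≤ ΔP) (mstar : Fin M)
    (D : Matrix (Fin M) (Fin M) ℝ)
    (hD : D = Matrix.of fun i j =>
      if i = j then
        (if i < mstar then (β i / α i) * (α mstar * β mstar) * ΔP
         else if i = mstar then
           (β mstar / α mstar) * ΔP * ∑ k ∈ Finset.Iio mstar, α k * β k
         else 0)
      else if i < mstar ∧ j = mstar then -(β i * β mstar * ΔP)
      else if j < mstar ∧ i = mstar then -(β j * β mstar * ΔP)
      else 0) :
    D.PosSemidef := by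
  have key : D = ∑ k ∈ Finset.Iio mstar, (α k * β k * (α mstar * β mstar) * ΔP) •
      Matrix.vecMulVec (scaledDiff α mstar k) (star (scaledDiff α mstar k)) := by
    subst hD
    have hm := hα mstar
    ext i j
    have hi := hα i
    have hj := hα j
    simp only [Matrix.of_apply, Matrix.sum_apply, Matrix.smul_apply, Matrix.vecMulVec_apply,
      star_trivial, smul_eq_mul, scaledDiff]
    have hmem : ∀ k ∈ Finset.Iio mstar, mstar ≠ k := fun k hk =>
      (Finset.mem_Iio.mp hk).ne'
    by_cases him : i = mstar
    · subst him
      by_cases hij : i = j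
      · subst hij
        simp only [if_true, lt_irrefl, if_false]
        rw [Finset.mul_sum]
        refine Finset.sum_congr rfl fun k hk => ?_
        rw [if_neg (hmem k hk)]
        field_simp
        ring
      · have hsum : ∀ k ∈ Finset.Iio i,
            α k * β k * (α i * β i) * ΔP * (((if i = k then (α k)⁻¹ else 0) -
              (if i = i then (α i)⁻¹ else 0)) * ((if j = k then (α k)⁻¹ else 0) -
              (if j = i then (α i)⁻¹ else 0))) =
            if j = k then -(β k * β i * ΔP) else 0 := by
          intro k hk
          have hk' := hα k
          rw [if_neg (hmem k hk), if_neg (Ne.symm hij), if_pos rfl]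
          split_ifs <;> (field_simp; try ring)
        rw [Finset.sum_congr rfl hsum, Finset.sum_ite_eq]
        simp [hij]
    · by_cases hjm : j = mstar
      · subst hjm
        have hsum : ∀ k ∈ Finset.Iio j,
            α k * β k * (α j * β j) * ΔP * (((if i = k then (α k)⁻¹ else 0) -
              (if i = j then (α j)⁻¹ else 0)) * ((if j = k then (α k)⁻¹ else 0) -
              (if j = j then (α j)⁻¹ else 0))) =
            if i = k then -(β k * β j * ΔP) else 0 := by
          intro k hk
          have hk' := hα k
          rw [if_neg (hmem k hk), if_neg him, if_pos rfl]
          split_ifs <;> (field_simp; try ring)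
        rw [Finset.sum_congr rfl hsum, Finset.sum_ite_eq]
        simp [him]
      · have hsum : ∀ k ∈ Finset.Iio mstar,
            α k * β k * (α mstar * β mstar) * ΔP * (((if i = k then (α k)⁻¹ else 0) -
              (if i = mstar then (α mstar)⁻¹ else 0)) * ((if j = k then (α k)⁻¹ else 0) -
              (if j = mstar then (α mstar)⁻¹ else 0))) =
            if i = k then (if i = j then (β k / α k) * (α mstar * β mstar) * ΔP else 0)
              else 0 := by
          intro k hk
          have hk' := hα k
          rw [if_neg hjm, if_neg him]
          by_cases hik : i = k
          · subst hik
            by_cases hij : i = j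
            · subst hij
              simp only [if_true]
              field_simp
              ring
            · simp [hij, Ne.symm hij]
          · simp [hik]
        rw [Finset.sum_congr rfl hsum, Finset.sum_ite_eq]
        by_cases hij : i = j <;> simp [hij, him, hjm]
  rw [key]
  exact Matrix.posSemidef_sum _ fun k _ => (Matrix.posSemidef_vecMulVec_self_star _).smul
    (mul_nonneg (mul_nonneg (hαβ k) (hαβ mstar)) hΔP)
end

section
/- Suppose the channel with noise powers σ²_{Z_1} ≥ … ≥ σ²_{Z_M} > 0 is matched, i.e. Σ^{(0)} is positive semidefinite. Then for any noise powers σ²_{Z⁺_1} ≥ σ²_{Z⁺_2} ≥ … ≥ σ²_{Z⁺_M} > 0 with σ²_{Z⁺_m} ≥ σ²_{Z_m} for every m, the corresponding matrix Σ^{(0)+} (built with B⁺_m = Pσ²_{Z⁺_m}/(P+σ²_{Z⁺_m}) in place of B_m) is also positive semidefinite, i.e. the more noisy channel is also matched. -/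
open Matrix BigOperators Finset

/-- The matrix `Σ^{(0)} = Σ_V − Σ_S + P β̄ β̄ᵀ` of the matching condition. -/
noncomputable def Sigma0 {M : ℕ} (SigS : Matrix (Fin M) (Fin M) ℝ)
    (α β : Fin M → ℝ) (P : ℝ) (B : Fin M → ℝ) : Matrix (Fin M) (Fin M) ℝ :=
  SigmaV α β B - SigS + P • vecMulVec β β

/-- The change of variables `x i = α i * y i` turns `SigmaV` into a weighted graph Laplacian. -/
theorem SigmaV_quadratic_form {M : ℕ} {α : Fin M → ℝ} (hα : ∀ m, α m ≠ 0) (β B y : Fin M → ℝ) :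
    (fun i => α i * y i) ⬝ᵥ (SigmaV α β B *ᵥ fun i => α i * y i) =
      (∑ i, ∑ j, (α i * β i) * (α j * β j) * B (max i j) * (y i - y j) ^ 2) / 2 := by
  have hentry (i j : Fin M) : α i * SigmaV α β B i j * α j =
      (if i = j then α i * β i * ∑ k, α k * β k * B (max i k) else 0) -
        (α i * β i) * (α j * β j) * B (max i j) := by
    rcases eq_or_ne i j with rfl | hij
    · have hsplit : ∑ k, α k * β k * B (max i k) =
          B i * ∑ k ∈ Finset.Iio i, α k * β k + α i * β i * B i +
            ∑ k ∈ Finset.Ioi i, α k * β k * B k := by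
        rw [← Finset.sum_filter_add_sum_filter_not univ (· ≤ i), Finset.filter_ge_eq_Iic]
        simp only [not_le]
        rw [Finset.filter_lt_eq_Ioi, ← Finset.Iio_insert, Finset.sum_insert (by simp),
          Finset.mul_sum, max_self, add_comm (α i * β i * B i)]
        congr 1
        · congr 1
          refine Finset.sum_congr rfl fun k hk => ?_
          rw [max_eq_left (Finset.mem_Iio.mp hk).le, mul_comm]
        · refine Finset.sum_congr rfl fun k hk => ?_
          rw [max_eq_right (Finset.mem_Ioi.mp hk).le]
      simp only [hsplit, SigmaV, of_apply, if_true, max_self]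
      field_simp [hα i]
      ring
    · simp only [SigmaV, of_apply, if_neg hij]
      ring
  have hlhs : (fun i => α i * y i) ⬝ᵥ (SigmaV α β B *ᵥ fun i => α i * y i) =
      ∑ i, ∑ j, (α i * SigmaV α β B i j * α j) * (y i * y j) := by
    simp only [dotProduct, mulVec, Finset.mul_sum]
    exact Finset.sum_congr rfl fun i _ => Finset.sum_congr rfl fun j _ => by ring
  have hleft : ∑ i, ∑ j, (α i * β i) * (α j * β j) * B (max i j) * y i ^ 2 =
      ∑ i, (α i * β i * ∑ k, α k * β k * B (max i k)) * (y i * y i) := by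
    refine Finset.sum_congr rfl fun i _ => ?_
    rw [Finset.mul_sum, Finset.sum_mul]
    exact Finset.sum_congr rfl fun j _ => by ring
  have hright : ∑ i, ∑ j, (α i * β i) * (α j * β j) * B (max i j) * y j ^ 2 =
      ∑ i, ∑ j, (α i * β i) * (α j * β j) * B (max i j) * y i ^ 2 := by
    rw [Finset.sum_comm]
    refine Finset.sum_congr rfl fun i _ => Finset.sum_congr rfl fun j _ => ?_
    rw [max_comm]
    ring
  have hexpand : ∑ i, ∑ j, (α i * β i) * (α j * β j) * B (max i j) * (y i - y j) ^ 2 =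
      ∑ i, ∑ j, (α i * β i) * (α j * β j) * B (max i j) * y i ^ 2 +
        ∑ i, ∑ j, (α i * β i) * (α j * β j) * B (max i j) * y j ^ 2 -
        2 * ∑ i, ∑ j, (α i * β i) * (α j * β j) * B (max i j) * (y i * y j) := by
    simp only [Finset.mul_sum, ← Finset.sum_add_distrib, ← Finset.sum_sub_distrib]
    exact Finset.sum_congr rfl fun i _ => Finset.sum_congr rfl fun j _ => by ring
  rw [hlhs, hexpand, hright, hleft]
  simp only [hentry, sub_mul, ite_mul, zero_mul, Finset.sum_sub_distrib, Finset.sum_ite_eq,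
    Finset.mem_univ, if_true]
  ring

theorem SigmaV_isHermitian {M : ℕ} (α β B : Fin M → ℝ) : (SigmaV α β B).IsHermitian := by
  refine IsHermitian.ext fun i j => ?_
  rcases eq_or_ne i j with rfl | hij
  · simp
  · simp only [SigmaV, of_apply, if_neg hij, if_neg hij.symm, star_trivial, max_comm j i]
    ring

theorem SigmaV_sub {M : ℕ} (α β B C : Fin M → ℝ) :
    SigmaV α β (fun m => B m - C m) = SigmaV α β B - SigmaV α β C := by
  ext i j
  simp only [SigmaV, of_apply, Matrix.sub_apply, mul_sub, Finset.sum_sub_distrib]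
  split_ifs <;> ring

/-- `SigmaV` is positive semidefinite when the weights `α m * β m` and `B` are nonnegative. -/
theorem SigmaV_posSemidef {M : ℕ} {α β B : Fin M → ℝ} (hα : ∀ m, α m ≠ 0)
    (hw : ∀ m, 0 ≤ α m * β m) (hB : ∀ m, 0 ≤ B m) : (SigmaV α β B).PosSemidef := by
  refine .of_dotProduct_mulVec_nonneg (SigmaV_isHermitian α β B) fun x => ?_
  obtain ⟨y, rfl⟩ : ∃ y : Fin M → ℝ, x = fun i => α i * y i :=
    ⟨fun i => x i / α i, funext fun i => (mul_div_cancel₀ (x i) (hα i)).symm⟩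
  rw [star_trivial, SigmaV_quadratic_form hα]
  refine div_nonneg (Finset.sum_nonneg fun i _ => Finset.sum_nonneg fun j _ => ?_) two_pos.le
  exact mul_nonneg (mul_nonneg (mul_nonneg (hw i) (hw j)) (hB _)) (sq_nonneg _)

/-- If `SigmaV` is positive semidefinite with `B > 0` and the weights `α m * β m` have positive sum,
then they are all nonnegative. -/
theorem SigmaV_weights_nonneg {M : ℕ} {α β B : Fin M → ℝ} (hα : ∀ m, α m ≠ 0)
    (hB : ∀ m, 0 < B m) (hsum : 0 < ∑ m, α m * β m) (hV : (SigmaV α β B).PosSemidef) (m : Fin M) :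
    0 ≤ α m * β m := by
  by_contra! hm
  obtain ⟨n, -, hn⟩ := Finset.exists_lt_of_sum_lt (f := fun _ : Fin M => (0 : ℝ))
    (g := fun k => α k * β k) (s := univ) (by simpa using hsum)
  set y : Fin M → ℝ := fun i => if 0 ≤ α i * β i then 1 else 0 with hy
  have hq := hV.dotProduct_mulVec_nonneg fun i => α i * y i
  rw [star_trivial, SigmaV_quadratic_form hα] at hq
  have hterm (i j : Fin M) :
      (α i * β i) * (α j * β j) * B (max i j) * (y i - y j) ^ 2 ≤ 0 := by
    by_cases hi : 0 ≤ α i * β i <;> by_cases hj : 0 ≤ α j * β j <;>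
      simp only [hy, hi, hj, if_true, if_false, sub_self, sub_zero, zero_sub, even_two.neg_pow,
        one_pow, mul_one, ne_eq, OfNat.ofNat_ne_zero, not_false_eq_true, zero_pow, mul_zero,
        le_refl]
    · exact mul_nonpos_of_nonpos_of_nonneg
        (mul_nonpos_of_nonneg_of_nonpos hi (not_le.mp hj).le) (hB _).le
    · exact mul_nonpos_of_nonpos_of_nonneg
        (mul_nonpos_of_nonpos_of_nonneg (not_le.mp hi).le hj) (hB _).le
  have hneg : (α m * β m) * (α n * β n) * B (max m n) * (y m - y n) ^ 2 < 0 := by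
    simp only [hy, if_neg hm.not_ge, if_pos hn.le]
    have := mul_neg_of_neg_of_pos (mul_neg_of_neg_of_pos hm hn) (hB (max m n))
    linarith
  have hlt : ∑ i, ∑ j, (α i * β i) * (α j * β j) * B (max i j) * (y i - y j) ^ 2 < 0 :=
    Finset.sum_neg' (fun i _ => Finset.sum_nonpos fun j _ => hterm i j)
      ⟨m, Finset.mem_univ m, Finset.sum_neg' (fun j _ => hterm m j) ⟨n, Finset.mem_univ n, hneg⟩⟩
  linarith

/-- Subtracting from `S` the rank-one part along `S *ᵥ a` leaves a positive semidefinite matrix. -/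
theorem posSemidef_sub_smul_vecMulVec {n : Type*} [Fintype n] {S : Matrix n n ℝ}
    (hS : S.PosSemidef) (a : n → ℝ) {P : ℝ} (hP : P = a ⬝ᵥ (S *ᵥ a)) (hPpos : 0 < P) :
    (S - P • vecMulVec (fun m => (S *ᵥ a) m / P) (fun m => (S *ᵥ a) m / P)).PosSemidef := by
  refine .of_dotProduct_mulVec_nonneg (hS.isHermitian.sub ?_) fun x => ?_
  · refine IsHermitian.ext fun i j => ?_
    simp [vecMulVec_apply, mul_comm]
  · have hdiv : (fun m => (S *ᵥ a) m / P) = P⁻¹ • (S *ᵥ a) := by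
      ext m
      simp [div_eq_inv_mul]
    have hsymm : a ⬝ᵥ (S *ᵥ x) = x ⬝ᵥ (S *ᵥ a) := by
      have hT : Sᵀ = S := hS.isHermitian
      rw [dotProduct_mulVec, ← mulVec_transpose, hT, dotProduct_comm]
    have hsq := hS.dotProduct_mulVec_nonneg (x - (x ⬝ᵥ (S *ᵥ a) / P) • a)
    simp only [star_trivial, mulVec_sub, mulVec_smul, sub_dotProduct, dotProduct_sub,
      smul_dotProduct, dotProduct_smul, hsymm, ← hP, smul_eq_mul] at hsq
    simp only [hdiv, star_trivial, sub_mulVec, smul_mulVec, vecMulVec_mulVec, dotProduct_sub,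
      dotProduct_smul, smul_dotProduct, smul_eq_mul,
      op_smul_eq_smul, dotProduct_comm (S *ᵥ a) x]
    field_simp at hsq ⊢
    linarith

/-- Corollary 1: if the channel with noise powers `σZ` is matched
(`Σ^{(0)} ⪰ 0`), then any more noisy channel `σZp` (with `σZp m ≥ σZ m` for all `m`)
is also matched. -/
theorem stmt_3 {M : ℕ} (hM : 2 ≤ M)
    (SigS : Matrix (Fin M) (Fin M) ℝ) (hS : SigS.PosDef)
    (α : Fin M → ℝ) (hα : ∀ m, α m ≠ 0)
    (P : ℝ) (hP : P = α ⬝ᵥ (SigS *ᵥ α)) (hPpos : 0 < P)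
    (β : Fin M → ℝ) (hβ : β = fun m => (SigS *ᵥ α) m / P)
    (σZ : Fin M → ℝ) (hσmono : ∀ i j : Fin M, i ≤ j → σZ j ≤ σZ i)
    (hσpos : ∀ m, 0 < σZ m)
    (σZp : Fin M → ℝ) (hσpmono : ∀ i j : Fin M, i ≤ j → σZp j ≤ σZp i)
    (hσppos : ∀ m, 0 < σZp m)
    (hle : ∀ m, σZ m ≤ σZp m)
    (hmatched : (Sigma0 SigS α β P (fun m => P * σZ m / (P + σZ m))).PosSemidef) :
    (Sigma0 SigS α β P (fun m => P * σZp m / (P + σZp m))).PosSemidef := by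
  have hsum : 0 < ∑ m, α m * β m := by
    have h : ∑ m, α m * β m = 1 := by
      simp only [hβ, ← mul_div_assoc, ← Finset.sum_div]
      rw [div_eq_one_iff_eq hPpos.ne', hP]
      rfl
    rw [h]
    exact one_pos
  have hV : (SigmaV α β fun m => P * σZ m / (P + σZ m)).PosSemidef := by
    have h := hmatched.add (posSemidef_sub_smul_vecMulVec hS.posSemidef α hP hPpos)
    rw [← hβ] at h
    convert h using 1
    rw [Sigma0]
    abel
  have hw := SigmaV_weights_nonneg hα
    (fun m => div_pos (mul_pos hPpos (hσpos m)) (add_pos hPpos (hσpos m))) hsum hV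
  have hB (m : Fin M) : 0 ≤ P * σZp m / (P + σZp m) - P * σZ m / (P + σZ m) := by
    rw [sub_nonneg, div_le_div_iff₀ (add_pos hPpos (hσpos m)) (add_pos hPpos (hσppos m))]
    nlinarith [mul_le_mul_of_nonneg_left (hle m) (mul_pos hPpos hPpos).le]
  have h := hmatched.add (SigmaV_posSemidef hα hw hB)
  rw [SigmaV_sub] at h
  convert h using 1
  simp only [Sigma0]
  abel
end

section
/- Assume α_mβ_m > 0 for all m, that the largest eigenvalue of ΠΣ_SΠ is 1 with multiplicity 1 (with eigenvector v₁ = (√(α_mβ_m))_m), and let λ₂ < 1 denote its second largest eigenvalue. Then for any σ²_Z > 0 with λ₂ ≤ σ²_Z/(P+σ²_Z), the matrix inequality (Pσ²_Z/(P+σ²_Z))·diag(β_1/α_1,…,β_M/α_M) + (P − Pσ²_Z/(P+σ²_Z))·β̄β̄ᵀ ⪰ Σ_S holds; equivalently, the equal-noise channel σ²_{Z_1} = … = σ²_{Z_M} = σ²_Z is matched (Σ^{(0)} ⪰ 0). -/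
open Matrix BigOperators Finset

/-- The diagonal matrix `Π` with `m`-th diagonal entry `√(α_m/(P β_m))`. -/
noncomputable def PiMat {M : ℕ} (α β : Fin M → ℝ) (P : ℝ) : Matrix (Fin M) (Fin M) ℝ :=
  Matrix.diagonal fun m => Real.sqrt (α m / (P * β m))

/-- The Perron vector `v₁ = (√(α_m β_m))_m`. -/
noncomputable def vOne {M : ℕ} (α β : Fin M → ℝ) : Fin M → ℝ :=
  fun m => Real.sqrt (α m * β m)

/-- A real symmetric matrix is positive semidefinite if all its eigenvalues are nonnegative. -/
theorem posSemidef_of_forall_eigenvalue_nonneg {n : Type*} [Fintype n]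
    {N : Matrix n n ℝ} (hN : N.IsHermitian)
    (h : ∀ (μ : ℝ) (w : n → ℝ), w ≠ 0 → N *ᵥ w = μ • w → 0 ≤ μ) : N.PosSemidef := by
  classical
  rw [hN.posSemidef_iff_eigenvalues_nonneg]
  intro i
  refine h _ _ ?_ (hN.mulVec_eigenvectorBasis i)
  intro h0
  apply hN.eigenvectorBasis.orthonormal.ne_zero i
  ext j
  exact congrFun h0 j

/-- If `v` is a unit eigenvector of the symmetric matrix `A` with eigenvalue `1` and all
eigenvalues on the orthogonal complement of `v` are at most `t`, then
`t I + (1 - t) v vᵀ - A` is positive semidefinite. -/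
theorem posSemidef_smul_one_add_vecMulVec_sub {n : Type*} [Fintype n] [DecidableEq n]
    {A : Matrix n n ℝ} (hA : A.IsHermitian) {v : n → ℝ} (hv : A *ᵥ v = v)
    (hvv : v ⬝ᵥ v = 1) (t : ℝ)
    (h : ∀ (μ : ℝ) (w : n → ℝ), w ≠ 0 → w ⬝ᵥ v = 0 → A *ᵥ w = μ • w → μ ≤ t) :
    (t • (1 : Matrix n n ℝ) + (1 - t) • vecMulVec v v - A).PosSemidef := by
  have hAw (w : n → ℝ) : v ⬝ᵥ (A *ᵥ w) = v ⬝ᵥ w := by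
    rw [dotProduct_mulVec, ← mulVec_transpose]
    have : Aᵀ = A := by simpa [conjTranspose_eq_transpose_of_trivial] using hA.eq
    rw [this, hv]
  have hmul (w : n → ℝ) : (t • (1 : Matrix n n ℝ) + (1 - t) • vecMulVec v v - A) *ᵥ w =
      t • w + ((1 - t) * (v ⬝ᵥ w)) • v - A *ᵥ w := by
    ext i
    simp [sub_mulVec, add_mulVec, smul_mulVec, vecMulVec_mulVec]
    ring
  refine posSemidef_of_forall_eigenvalue_nonneg ?_ ?_
  · have hV : (vecMulVec v v).IsHermitian := by
      ext i j
      simp [vecMulVec_apply, mul_comm]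
    refine IsHermitian.sub (IsHermitian.add ?_ ?_) hA
    · ext i j
      simp [Matrix.one_apply, eq_comm]
    · rw [IsHermitian, conjTranspose_smul, hV.eq, star_trivial]
  · intro μ w hw hμ
    rw [hmul] at hμ
    have h0 := congrArg (fun x => v ⬝ᵥ x) hμ
    simp only [dotProduct_sub, dotProduct_add, dotProduct_smul, hAw, hvv, smul_eq_mul] at h0
    have h1 : μ * (v ⬝ᵥ w) = 0 := by linarith
    rcases mul_eq_zero.1 h1 with h2 | h2
    · exact h2.ge
    · have h3 : A *ᵥ w = (t - μ) • w := by
        rw [h2] at hμ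
        rw [sub_smul, ← hμ]
        simp
      have := h _ w hw (by rw [dotProduct_comm]; exact h2) h3
      linarith

/-- If `v` is a unit eigenvector of `A` with eigenvalue `1`, the eigenvalues on the orthogonal
complement of `v` are smaller than `1`, and `u` is another unit eigenvector with eigenvalue `1`,
then `u` and `v` span the same rank-one projection. -/
theorem vecMulVec_eq_of_unit_eigenvectors {n : Type*} [Fintype n]
    {A : Matrix n n ℝ} {u v : n → ℝ} (hv : A *ᵥ v = v) (hu : A *ᵥ u = u)
    (hvv : v ⬝ᵥ v = 1) (huu : u ⬝ᵥ u = 1)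
    (h : ∀ (μ : ℝ) (w : n → ℝ), w ≠ 0 → w ⬝ᵥ v = 0 → A *ᵥ w = μ • w → μ < 1) :
    vecMulVec u u = vecMulVec v v := by
  have huv : u = (u ⬝ᵥ v) • v := by
    by_contra hne
    refine lt_irrefl _ (h 1 (u - (u ⬝ᵥ v) • v) (sub_ne_zero.2 hne) ?_ ?_)
    · simp [sub_dotProduct, hvv]
    · simp [mulVec_sub, mulVec_smul, hu, hv]
  have hc : (u ⬝ᵥ v) * (u ⬝ᵥ v) = 1 := by
    have h1 := huu
    nth_rewrite 2 [huv] at h1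
    simpa [dotProduct_smul] using h1
  rw [huv, smul_vecMulVec, vecMulVec_smul, smul_smul, hc, one_smul]

/-- With equal noise levels, `Σ_V` is a diagonal matrix minus a rank-one matrix. -/
theorem SigmaV_const {M : ℕ} {α β : Fin M → ℝ} (hα : ∀ m, α m ≠ 0)
    (hsum : ∑ k, α k * β k = 1) (b : ℝ) :
    SigmaV α β (fun _ => b) =
      b • Matrix.diagonal (fun m => β m / α m) - b • vecMulVec β β := by
  ext i j
  by_cases hij : i = j
  · subst hij
    have hdisj : Disjoint (Finset.Iio i) (Finset.Ioi i) := by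
      rw [Finset.disjoint_left]
      intro a ha hb
      exact lt_asymm (Finset.mem_Iio.1 ha) (Finset.mem_Ioi.1 hb)
    have hU : Finset.Iio i ∪ Finset.Ioi i = Finset.univ.erase i := by
      ext a
      simp [lt_or_lt_iff_ne]
    have hs : ∑ k ∈ Finset.Iio i, α k * β k + ∑ k ∈ Finset.Ioi i, α k * β k
        = 1 - α i * β i := by
      rw [← Finset.sum_union hdisj, hU, ← hsum,
        ← Finset.add_sum_erase _ _ (Finset.mem_univ i)]
      ring
    have hi := hα i
    simp only [SigmaV, of_apply, if_true, Matrix.sub_apply, Matrix.smul_apply, diagonal_apply_eq,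
      vecMulVec_apply, smul_eq_mul, ← Finset.sum_mul]
    rw [mul_comm (∑ k ∈ Finset.Ioi i, α k * β k) b, ← mul_add, hs]
    field_simp
  · simp [SigmaV, hij, vecMulVec_apply]
    ring

/-- sufficiency direction of Corollary 2: if `α_m β_m > 0` for all `m`,
`v₁` is an eigenvector of `ΠΣ_SΠ` with eigenvalue `1`, every eigenvalue with eigenvector
orthogonal to `v₁` is at most `λ₂ < 1`, and `σ²_Z > 0` satisfies `λ₂ ≤ σ²_Z/(P+σ²_Z)`,
then `(Pσ²_Z/(P+σ²_Z))·diag(β/α) + (P − Pσ²_Z/(P+σ²_Z))·β̄β̄ᵀ ⪰ Σ_S`; equivalently, the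
equal-noise channel `σ²_{Z_1} = … = σ²_{Z_M} = σ²_Z` is matched (`Σ^{(0)} ⪰ 0`). -/
theorem stmt_6 {M : ℕ} (hM : 2 ≤ M)
    (SigS : Matrix (Fin M) (Fin M) ℝ) (hS : SigS.PosDef)
    (α : Fin M → ℝ) (hα : ∀ m, α m ≠ 0)
    (P : ℝ) (hP : P = α ⬝ᵥ (SigS *ᵥ α)) (hPpos : 0 < P)
    (β : Fin M → ℝ) (hβ : β = fun m => (SigS *ᵥ α) m / P)
    (hαβ : ∀ m, 0 < α m * β m)
    (hv1 : (PiMat α β P * SigS * PiMat α β P) *ᵥ vOne α β = vOne α β)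
    (l2 : ℝ) (hl2lt : l2 < 1)
    (hsec : ∀ (μ : ℝ) (w : Fin M → ℝ), w ≠ 0 → w ⬝ᵥ vOne α β = 0 →
      (PiMat α β P * SigS * PiMat α β P) *ᵥ w = μ • w → μ ≤ l2)
    (sz : ℝ) (hsz : 0 < sz) (hthr : l2 ≤ sz / (P + sz)) :
    ((P * sz / (P + sz)) • Matrix.diagonal (fun m => β m / α m) +
        (P - P * sz / (P + sz)) • vecMulVec β β - SigS).PosSemidef ∧
    (Sigma0 SigS α β P (fun _ => P * sz / (P + sz))).PosSemidef := by
  have hSα (m : Fin M) : (SigS *ᵥ α) m = P * β m := by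
    rw [hβ]
    field_simp
  have hsum : ∑ k, α k * β k = 1 := by
    have h1 : P = P * ∑ k, α k * β k := by
      nth_rewrite 1 [hP]
      rw [dotProduct, Finset.mul_sum]
      exact Finset.sum_congr rfl fun k _ => by rw [hSα]; ring
    exact (mul_left_cancel₀ hPpos.ne' (by rw [mul_one]; exact h1)).symm
  have hβ0 (m : Fin M) : β m ≠ 0 := (mul_ne_zero_iff.1 (hαβ m).ne').2
  have hpos (m : Fin M) : 0 < α m / (P * β m) := by
    have h1 : α m / (P * β m) = α m * β m / (P * β m ^ 2) := by
      have := hβ0 m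
      field_simp
    rw [h1]
    have := hβ0 m
    exact div_pos (hαβ m) (by positivity)
  set d : Fin M → ℝ := fun m => Real.sqrt (α m / (P * β m)) with hd
  have hd0 (m : Fin M) : d m ≠ 0 := (Real.sqrt_pos.2 (hpos m)).ne'
  have hdd (m : Fin M) : d m * d m = α m / (P * β m) := Real.mul_self_sqrt (hpos m).le
  have hPi : PiMat α β P = Matrix.diagonal d := rfl
  rw [hPi] at hv1 hsec
  set A := Matrix.diagonal d * SigS * Matrix.diagonal d with hA
  have hAapp (i j : Fin M) : A i j = d i * SigS i j * d j := by
    rw [hA, mul_diagonal, diagonal_mul]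
  have hSt (i j : Fin M) : SigS j i = SigS i j := by
    simpa using hS.isHermitian.apply i j
  have hAherm : A.IsHermitian := by
    ext i j
    rw [conjTranspose_apply, star_trivial, hAapp, hAapp, hSt]
    ring
  set v := vOne α β with hv
  have hvv : v ⬝ᵥ v = 1 := by
    rw [← hsum, dotProduct]
    exact Finset.sum_congr rfl fun k _ => Real.mul_self_sqrt (hαβ k).le
  set u : Fin M → ℝ := fun m => Real.sqrt P * (d m * β m) with hu
  have hPP : Real.sqrt P * Real.sqrt P = P := Real.mul_self_sqrt hPpos.le
  have hddβ (m : Fin M) : d m * d m * β m = α m / P := by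
    rw [hdd]
    have := hβ0 m
    field_simp
  have huapp (i j : Fin M) : u i * u j = P * (d i * β i * (d j * β j)) := by
    rw [← hPP, hu]
    ring
  have huu : u ⬝ᵥ u = 1 := by
    rw [← hsum, dotProduct]
    refine Finset.sum_congr rfl fun k _ => ?_
    calc u k * u k = P * (d k * d k * β k) * β k := by rw [huapp]; ring
      _ = α k * β k := by rw [hddβ]; field_simp
  have hAu : A *ᵥ u = u := by
    ext i
    calc (A *ᵥ u) i = ∑ j : Fin M, d i * Real.sqrt P / P * (SigS i j * α j) := by
          rw [mulVec, dotProduct]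
          refine Finset.sum_congr rfl fun j _ => ?_
          calc A i j * u j = d i * Real.sqrt P * SigS i j * (d j * d j * β j) := by
                rw [hAapp, hu]; ring
            _ = _ := by rw [hddβ]; ring
      _ = d i * Real.sqrt P / P * (SigS *ᵥ α) i := by
          rw [← Finset.mul_sum]
          rfl
      _ = u i := by
          rw [hSα, hu]
          field_simp
  have huv : vecMulVec u u = vecMulVec v v :=
    vecMulVec_eq_of_unit_eigenvectors hv1 hAu hvv huu fun μ w hw hwv hμ =>
      (hsec μ w hw hwv hμ).trans_lt hl2lt
  have hN := posSemidef_smul_one_add_vecMulVec_sub hAherm hv1 hvv (sz / (P + sz))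
    fun μ w hw hwv hμ => (hsec μ w hw hwv hμ).trans hthr
  rw [← huv] at hN
  have hmain : ((P * sz / (P + sz)) • Matrix.diagonal (fun m => β m / α m) +
      (P - P * sz / (P + sz)) • vecMulVec β β - SigS).PosSemidef := by
    have hconj := hN.conjTranspose_mul_mul_same (Matrix.diagonal fun m => (d m)⁻¹)
    convert hconj using 1
    ext i j
    rw [diagonal_conjTranspose, mul_diagonal, diagonal_mul]
    simp only [Matrix.sub_apply, Matrix.add_apply, Matrix.smul_apply, smul_eq_mul,
      vecMulVec_apply, hAapp, huapp, Pi.star_apply, star_trivial]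
    have hi := hd0 i
    have hj := hd0 j
    have hPs : P + sz ≠ 0 := by positivity
    by_cases hij : i = j
    · subst hij
      have hβα : β i / α i = (P * (d i * d i))⁻¹ := by
        rw [hdd]
        have := hβ0 i
        have := hα i
        field_simp
      rw [diagonal_apply_eq, one_apply_eq, hβα]
      field_simp
    · rw [diagonal_apply_ne _ hij, one_apply_ne hij]
      field_simp
      ring
  refine ⟨hmain, ?_⟩
  rw [Sigma0, SigmaV_const hα hsum]
  convert hmain using 1
  rw [sub_smul]
  abel
end

section
/- There exist noise powers σ²_{Z_1} ≥ σ²_{Z_2} ≥ … ≥ σ²_{Z_M} > 0 making the channel matched (Σ^{(0)} ⪰ 0) if and only if α_mβ_m > 0 for all m and the matrix ΠΣ_SΠ has largest eigenvalue 1 with multiplicity 1. Moreover, when this condition holds, every channel with σ²_{Z_1} ≥ … ≥ σ²_{Z_M} ≥ σ²_Z is matched, where σ²_Z = λ₂P/(1−λ₂) and λ₂ is the second largest eigenvalue of ΠΣ_SΠ. -/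
open Matrix BigOperators Finset

/-- A channel with noise powers `σZ` is matched if `Σ^{(0)} ⪰ 0`
(with `B_m = P σ²_{Z_m}/(P + σ²_{Z_m})`). -/
noncomputable def Matched {M : ℕ} (SigS : Matrix (Fin M) (Fin M) ℝ)
    (α β : Fin M → ℝ) (P : ℝ) (σZ : Fin M → ℝ) : Prop :=
  (Sigma0 SigS α β P (fun m => P * σZ m / (P + σZ m))).PosSemidef

/-- `A` has `1` as an eigenvalue, it is the largest eigenvalue, and it has multiplicity `1`
(the eigenspace of `1` is one-dimensional). -/
def LargestEigOneMultOne {M : ℕ} (A : Matrix (Fin M) (Fin M) ℝ) : Prop :=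
  (∃ v : Fin M → ℝ, v ≠ 0 ∧ A *ᵥ v = v) ∧
  (∀ (μ : ℝ) (v : Fin M → ℝ), v ≠ 0 → A *ᵥ v = μ • v → μ ≤ 1) ∧
  (∀ v w : Fin M → ℝ, v ≠ 0 → A *ᵥ v = v → A *ᵥ w = w → ∃ c : ℝ, w = c • v)

/-- `l2` is the second largest eigenvalue of the symmetric matrix `A`: it is attained by an
eigenvector orthogonal to the top eigenspace, and it dominates every eigenvalue attained by
an eigenvector orthogonal to the top eigenspace. -/
def IsSecondEig {M : ℕ} (A : Matrix (Fin M) (Fin M) ℝ) (l2 : ℝ) : Prop :=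
  (∃ v : Fin M → ℝ, v ≠ 0 ∧ (∀ u : Fin M → ℝ, A *ᵥ u = u → v ⬝ᵥ u = 0) ∧
    A *ᵥ v = l2 • v) ∧
  (∀ (μ : ℝ) (v : Fin M → ℝ), v ≠ 0 → (∀ u : Fin M → ℝ, A *ᵥ u = u → v ⬝ᵥ u = 0) →
    A *ᵥ v = μ • v → μ ≤ l2)

section Auxiliary

/-- Quadratic form of a Hermitian matrix bounded by the eigenvalues whose eigenvectors are not
orthogonal to the argument. -/
theorem Matrix.IsHermitian.dotProduct_mulVec_le {n : Type*} [Fintype n] [DecidableEq n]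
    {A : Matrix n n ℝ} (hA : A.IsHermitian) (l : ℝ) (v : n → ℝ)
    (h : ∀ i, (hA.eigenvectorBasis i).ofLp ⬝ᵥ v ≠ 0 → hA.eigenvalues i ≤ l) :
    v ⬝ᵥ A *ᵥ v ≤ l * (v ⬝ᵥ v) := by
  have parseval : ∀ x y : n → ℝ,
      x ⬝ᵥ y = ∑ i, (hA.eigenvectorBasis i).ofLp ⬝ᵥ x * ((hA.eigenvectorBasis i).ofLp ⬝ᵥ y) := by
    intro x y
    have := hA.eigenvectorBasis.sum_inner_mul_inner (WithLp.toLp 2 x) (WithLp.toLp 2 y)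
    simp only [EuclideanSpace.inner_eq_star_dotProduct, star_trivial] at this
    rw [dotProduct_comm x y, ← this]
    exact Finset.sum_congr rfl fun i _ => by rw [dotProduct_comm y]
  rw [parseval v (A *ᵥ v), parseval v v, Finset.mul_sum]
  refine Finset.sum_le_sum fun i _ => ?_
  have hT : Aᵀ = A := by simpa [conjTranspose_eq_transpose_of_trivial] using hA.eq
  have key : (hA.eigenvectorBasis i).ofLp ⬝ᵥ A *ᵥ v
      = hA.eigenvalues i * ((hA.eigenvectorBasis i).ofLp ⬝ᵥ v) := by
    rw [dotProduct_mulVec, ← mulVec_transpose, hT, hA.mulVec_eigenvectorBasis, smul_dotProduct,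
      smul_eq_mul]
  rw [key]
  by_cases h0 : (hA.eigenvectorBasis i).ofLp ⬝ᵥ v = 0
  · simp [h0]
  · nlinarith [mul_le_mul_of_nonneg_right (h i h0)
      (mul_self_nonneg ((hA.eigenvectorBasis i).ofLp ⬝ᵥ v))]

/-- Expansion of a weighted sum of squared differences with symmetric weights. -/
theorem sum_sum_mul_sub_sq {n : Type*} [Fintype n] (w : n → n → ℝ) (hw : ∀ i j, w i j = w j i)
    (u : n → ℝ) :
    (∑ i, ∑ j, w i j * (u i - u j) ^ 2) =
      2 * ((∑ i, u i ^ 2 * ∑ j, w i j) - ∑ i, ∑ j, w i j * (u i * u j)) := by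
  have h1 : (∑ i, ∑ j, w i j * u j ^ 2) = ∑ i, ∑ j, w i j * u i ^ 2 := by
    rw [Finset.sum_comm]
    exact Finset.sum_congr rfl fun i _ => Finset.sum_congr rfl fun j _ => by rw [hw]
  have h2 : (∑ i, u i ^ 2 * ∑ j, w i j) = ∑ i, ∑ j, w i j * u i ^ 2 := by
    simp only [mul_comm (_ ^ 2), Finset.sum_mul]
  have h3 : ∀ i j, w i j * (u i - u j) ^ 2
      = w i j * u i ^ 2 + w i j * u j ^ 2 - 2 * (w i j * (u i * u j)) := fun i j => by ring
  simp only [h3, Finset.sum_sub_distrib, Finset.sum_add_distrib, ← Finset.mul_sum, h1] at *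
  rw [h2]
  ring

theorem sum_sum_mul_mul_sub_sq {n : Type*} [Fintype n] (p : n → ℝ) (hp : ∑ i, p i = 1)
    (u : n → ℝ) :
    (∑ i, ∑ j, p i * p j * (u i - u j) ^ 2) =
      2 * ((∑ i, p i * u i ^ 2) - (∑ i, p i * u i) ^ 2) := by
  rw [sum_sum_mul_sub_sq (fun i j => p i * p j) (fun i j => mul_comm _ _)]
  simp only [← Finset.mul_sum, hp, mul_one]
  congr 2
  · exact Finset.sum_congr rfl fun i _ => by ring
  · rw [sq, Finset.sum_mul_sum]
    exact Finset.sum_congr rfl fun i _ => Finset.sum_congr rfl fun j _ => by ring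

variable {M : ℕ}

theorem SigmaV_apply_mul {α : Fin M → ℝ} (hα : ∀ m, α m ≠ 0) (β B : Fin M → ℝ) (i j : Fin M) :
    α i * α j * SigmaV α β B i j =
      (if i = j then ∑ k, α i * β i * (α k * β k) * B (max i k) else 0)
        - α i * β i * (α j * β j) * B (max i j) := by
  unfold SigmaV
  rw [of_apply]
  split_ifs with hij
  · subst hij
    have hsplit : (∑ k, α i * β i * (α k * β k) * B (max i k)) =
        α i * β i * (B i * ∑ k ∈ Finset.Iio i, α k * β k) + α i * β i * (α i * β i) * B i
          + α i * β i * ∑ k ∈ Finset.Ioi i, α k * β k * B k := by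
      have hu : (Finset.univ : Finset (Fin M)) = Finset.Iio i ∪ {i} ∪ Finset.Ioi i := by
        ext k
        simp only [Finset.mem_univ, Finset.mem_union, Finset.mem_Iio, Finset.mem_singleton,
          Finset.mem_Ioi, true_iff]
        rcases lt_trichotomy k i with h | h | h <;> simp [h]
      rw [hu, Finset.sum_union, Finset.sum_union, Finset.sum_singleton, max_self]
      · congr 1
        · congr 1
          rw [Finset.mul_sum, Finset.mul_sum]
          refine Finset.sum_congr rfl fun k hk => ?_
          rw [max_eq_left (Finset.mem_Iio.1 hk).le]
          ring
        · rw [Finset.mul_sum]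
          refine Finset.sum_congr rfl fun k hk => ?_
          rw [max_eq_right (Finset.mem_Ioi.1 hk).le]
          ring
      · simp
      · rw [Finset.disjoint_left]
        intro k hk hk'
        simp only [Finset.mem_union, Finset.mem_Iio, Finset.mem_singleton, Finset.mem_Ioi] at hk hk'
        rcases hk with h | h
        · exact absurd hk' (not_lt.2 h.le)
        · exact absurd hk' (by simp [h])
    rw [hsplit, max_self]
    have := hα i
    field_simp
    ring
  · ring

theorem dotProduct_SigmaV_mulVec {α : Fin M → ℝ} (hα : ∀ m, α m ≠ 0) (β B u : Fin M → ℝ) :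
    (α * u) ⬝ᵥ SigmaV α β B *ᵥ (α * u) =
      (∑ i, ∑ j, α i * β i * (α j * β j) * B (max i j) * (u i - u j) ^ 2) / 2 := by
  rw [sum_sum_mul_sub_sq (fun i j => α i * β i * (α j * β j) * B (max i j))
    (fun i j => by rw [max_comm]; ring)]
  rw [mul_div_cancel_left₀ _ (two_ne_zero), ← Finset.sum_sub_distrib]
  simp only [dotProduct, mulVec, Finset.mul_sum, Pi.mul_apply]
  refine Finset.sum_congr rfl fun i _ => ?_
  have h : ∀ j, α i * u i * (SigmaV α β B i j * (α j * u j)) =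
      (if i = j then u i ^ 2 * ∑ k, α i * β i * (α k * β k) * B (max i k) else 0)
        - α i * β i * (α j * β j) * B (max i j) * (u i * u j) := by
    intro j
    have := SigmaV_apply_mul hα β B i j
    calc _ = u i * u j * (α i * α j * SigmaV α β B i j) := by ring
      _ = _ := by
        rw [this]
        split_ifs with hij
        · subst hij; ring
        · ring
  simp only [h, Finset.sum_sub_distrib, Finset.sum_ite_eq, Finset.mem_univ, if_true,
    Finset.mul_sum]

theorem Matrix.IsSymm.dotProduct_mulVec_comm {n : Type*} [Fintype n] {A : Matrix n n ℝ}
    (hA : A.IsSymm) (x y : n → ℝ) : x ⬝ᵥ A *ᵥ y = y ⬝ᵥ A *ᵥ x := by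
  rw [dotProduct_mulVec, ← mulVec_transpose, hA.eq, dotProduct_comm]

/-- The source statistics of the matching problem. -/
structure SourceData (SigS : Matrix (Fin M) (Fin M) ℝ) (α β : Fin M → ℝ) (P : ℝ) : Prop where
  posDef : SigS.PosDef
  ne_zero : ∀ m, α m ≠ 0
  pos : 0 < P
  mulVec_eq : SigS *ᵥ α = P • β
  sum_eq_one : ∑ m, α m * β m = 1

namespace SourceData

variable {SigS : Matrix (Fin M) (Fin M) ℝ} {α β : Fin M → ℝ} {P : ℝ}

theorem isSymm (h : SourceData SigS α β P) : SigS.IsSymm := by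
  simpa [Matrix.IsSymm, conjTranspose_eq_transpose_of_trivial] using h.posDef.isHermitian.eq

theorem quadForm_center (h : SourceData SigS α β P) (u : Fin M → ℝ) :
    (α * u) ⬝ᵥ SigS *ᵥ (α * u) =
      (α * fun i => u i - ∑ k, α k * β k * u k) ⬝ᵥ
        SigS *ᵥ (α * fun i => u i - ∑ k, α k * β k * u k)
      + P * (∑ k, α k * β k * u k) ^ 2 := by
  set c := ∑ k, α k * β k * u k with hc
  have hx : (α * fun i => u i - c) = α * u - c • α := by
    ext i; simp; ring
  have h1 : (α * u) ⬝ᵥ SigS *ᵥ α = P * c := by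
    rw [h.mulVec_eq, dotProduct_smul, smul_eq_mul, hc]
    congr 1
    exact Finset.sum_congr rfl fun i _ => by simp; ring
  have h2 : α ⬝ᵥ SigS *ᵥ α = P := by
    rw [h.mulVec_eq, dotProduct_smul, smul_eq_mul]
    have : α ⬝ᵥ β = 1 := h.sum_eq_one
    rw [this, mul_one]
  have h3 := h.isSymm.dotProduct_mulVec_comm α (α * u)
  rw [hx, mulVec_sub, mulVec_smul]
  simp only [sub_dotProduct, dotProduct_sub, smul_dotProduct, dotProduct_smul, smul_eq_mul, h1, h2,
    h3]
  ring

theorem quadForm_Sigma0 (h : SourceData SigS α β P) (B u : Fin M → ℝ) :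
    (α * u) ⬝ᵥ Sigma0 SigS α β P B *ᵥ (α * u) =
      (∑ i, ∑ j, α i * β i * (α j * β j) * B (max i j) * (u i - u j) ^ 2) / 2
      - (α * fun i => u i - ∑ k, α k * β k * u k) ⬝ᵥ
        SigS *ᵥ (α * fun i => u i - ∑ k, α k * β k * u k) := by
  have h1 : (α * u) ⬝ᵥ (P • vecMulVec β β) *ᵥ (α * u) = P * (∑ k, α k * β k * u k) ^ 2 := by
    have hb : (α * u) ⬝ᵥ β = ∑ k, α k * β k * u k :=
      Finset.sum_congr rfl fun i _ => by simp; ring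
    rw [smul_mulVec, dotProduct_smul, dotProduct_mulVec, vecMul_vecMulVec, smul_dotProduct,
      dotProduct_comm β, hb, smul_eq_mul, smul_eq_mul]
    ring
  unfold Sigma0
  rw [add_mulVec, sub_mulVec, dotProduct_add, dotProduct_sub, h1,
    dotProduct_SigmaV_mulVec h.ne_zero, h.quadForm_center u]
  ring

theorem isHermitian_Sigma0 (h : SourceData SigS α β P) (B : Fin M → ℝ) :
    (Sigma0 SigS α β P B).IsHermitian := by
  refine Matrix.IsHermitian.ext fun i j => ?_
  have hs : SigS j i = SigS i j := h.isSymm.apply i j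
  have hv : SigmaV α β B j i = SigmaV α β B i j := by
    by_cases hij : i = j
    · rw [hij]
    · simp only [SigmaV, of_apply, if_neg hij, if_neg (Ne.symm hij), max_comm j i]
      ring
  simp only [Sigma0, Matrix.add_apply, Matrix.sub_apply, Matrix.smul_apply, vecMulVec_apply, star_trivial, hs, hv,
    mul_comm (β j)]

theorem posSemidef_Sigma0_iff (h : SourceData SigS α β P) (B : Fin M → ℝ) :
    (Sigma0 SigS α β P B).PosSemidef ↔ ∀ u : Fin M → ℝ,
      (α * fun i => u i - ∑ k, α k * β k * u k) ⬝ᵥ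
        SigS *ᵥ (α * fun i => u i - ∑ k, α k * β k * u k) ≤
      (∑ i, ∑ j, α i * β i * (α j * β j) * B (max i j) * (u i - u j) ^ 2) / 2 := by
  rw [posSemidef_iff_dotProduct_mulVec]
  constructor
  · intro hp u
    have := hp.2 (α * u)
    rw [star_trivial, h.quadForm_Sigma0] at this
    linarith
  · refine fun hu => ⟨h.isHermitian_Sigma0 B, fun x => ?_⟩
    have hx : x = α * (x / α) := by
      ext i
      simp only [Pi.mul_apply, Pi.div_apply]
      field_simp [h.ne_zero i]
    rw [star_trivial, hx, h.quadForm_Sigma0]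
    linarith [hu (x / α)]

/-- Matching forces all the weights `α m * β m` to be positive. -/
theorem mul_pos_of_posSemidef (h : SourceData SigS α β P) {B : Fin M → ℝ} (hB : ∀ m, 0 < B m)
    (hpsd : (Sigma0 SigS α β P B).PosSemidef) (m : Fin M) : 0 < α m * β m := by
  by_contra! hm
  set u : Fin M → ℝ := fun i => if α i * β i ≤ 0 then 1 else 0 with hu
  have h1 := (h.posSemidef_Sigma0_iff B).1 hpsd u
  have hL : (∑ i, ∑ j, α i * β i * (α j * β j) * B (max i j) * (u i - u j) ^ 2) ≤ 0 := by
    refine Finset.sum_nonpos fun i _ => Finset.sum_nonpos fun j _ => ?_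
    have hb := hB (max i j)
    by_cases hi : α i * β i ≤ 0 <;> by_cases hj : α j * β j ≤ 0
    · simp [hu, hi, hj]
    · simp only [hu, hi, hj, if_true, if_false]
      have := mul_nonpos_of_nonpos_of_nonneg hi (not_le.1 hj).le
      nlinarith
    · simp only [hu, hi, hj, if_true, if_false]
      have := mul_nonpos_of_nonneg_of_nonpos (not_le.1 hi).le hj
      nlinarith
    · simp [hu, hi, hj]
  set x := α * fun i => u i - ∑ k, α k * β k * u k with hx
  have hx0 : x = 0 := by
    by_contra hne
    have := h.posDef.dotProduct_mulVec_pos hne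
    rw [star_trivial] at this
    linarith
  have hc : ∀ i, u i = ∑ k, α k * β k * u k := by
    intro i
    have := congrFun hx0 i
    simp only [hx, Pi.mul_apply, Pi.zero_apply, mul_eq_zero, h.ne_zero i, false_or] at this
    linarith
  have hall : ∀ i, α i * β i ≤ 0 := by
    intro i
    by_contra hi
    have h2 : u i = u m := (hc i).trans (hc m).symm
    simp [hu, hi, hm] at h2
  have := Finset.sum_nonpos fun i (_ : i ∈ Finset.univ) => hall i
  rw [h.sum_eq_one] at this
  linarith

theorem quadForm_le_of_posSemidef (h : SourceData SigS α β P) {B : Fin M → ℝ}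
    (hB : ∀ m, B m < P) (hpos : ∀ m, 0 < α m * β m)
    (hpsd : (Sigma0 SigS α β P B).PosSemidef) (u : Fin M → ℝ) :
    (α * u) ⬝ᵥ SigS *ᵥ (α * u) ≤ P * ∑ i, α i * β i * u i ^ 2 ∧
    ((α * u) ⬝ᵥ SigS *ᵥ (α * u) = P * ∑ i, α i * β i * u i ^ 2 → ∀ i j, u i = u j) := by
  have h1 := (h.posSemidef_Sigma0_iff B).1 hpsd u
  have h2 := h.quadForm_center u
  have h3 := sum_sum_mul_mul_sub_sq (fun i => α i * β i) h.sum_eq_one u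
  have hterm : ∀ i j, 0 ≤ α i * β i * (α j * β j) * (P - B (max i j)) * (u i - u j) ^ 2 :=
    fun i j => mul_nonneg (mul_nonneg (mul_nonneg (hpos i).le (hpos j).le)
      (sub_nonneg.2 (hB _).le)) (sq_nonneg _)
  have h4 : (∑ i, ∑ j, α i * β i * (α j * β j) * (P - B (max i j)) * (u i - u j) ^ 2) =
      P * (∑ i, ∑ j, α i * β i * (α j * β j) * (u i - u j) ^ 2)
      - ∑ i, ∑ j, α i * β i * (α j * β j) * B (max i j) * (u i - u j) ^ 2 := by
    simp only [Finset.mul_sum, ← Finset.sum_sub_distrib]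
    exact Finset.sum_congr rfl fun i _ => Finset.sum_congr rfl fun j _ => by ring
  have h5 : 0 ≤ ∑ i, ∑ j, α i * β i * (α j * β j) * (P - B (max i j)) * (u i - u j) ^ 2 :=
    Finset.sum_nonneg fun i _ => Finset.sum_nonneg fun j _ => hterm i j
  rw [h3] at h4
  refine ⟨by linarith, fun heq i j => ?_⟩
  have h6 : (∑ i, ∑ j, α i * β i * (α j * β j) * (P - B (max i j)) * (u i - u j) ^ 2) = 0 := by
    linarith
  rw [Finset.sum_eq_zero_iff_of_nonneg
    fun i _ => Finset.sum_nonneg fun j _ => hterm i j] at h6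
  have h7 := h6 i (Finset.mem_univ _)
  rw [Finset.sum_eq_zero_iff_of_nonneg fun j _ => hterm i j] at h7
  have h8 := h7 j (Finset.mem_univ _)
  have h9 : 0 < α i * β i * (α j * β j) * (P - B (max i j)) :=
    mul_pos (mul_pos (hpos i) (hpos j)) (sub_pos.2 (hB _))
  exact sub_eq_zero.1 (pow_eq_zero_iff two_ne_zero |>.1 ((mul_eq_zero.1 h8).resolve_left h9.ne'))

end SourceData

/-- The diagonal entries of `Π`. -/
noncomputable def piEntry (α β : Fin M → ℝ) (P : ℝ) (m : Fin M) : ℝ :=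
  Real.sqrt (α m / (P * β m))

/-- The vector `v` with `Π v = α * u`. -/
noncomputable def scaled (α β : Fin M → ℝ) (P : ℝ) (u : Fin M → ℝ) : Fin M → ℝ :=
  fun m => α m / piEntry α β P m * u m

namespace SourceData

variable {SigS : Matrix (Fin M) (Fin M) ℝ} {α β : Fin M → ℝ} {P : ℝ}

theorem div_pos (h : SourceData SigS α β P) (hpos : ∀ m, 0 < α m * β m) (m : Fin M) :
    0 < α m / (P * β m) := by
  have hb : β m ≠ 0 := right_ne_zero_of_mul (hpos m).ne'
  have : α m / (P * β m) = α m * β m / (P * β m ^ 2) := by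
    field_simp
  rw [this]
  have := h.pos
  have := hpos m
  positivity

theorem piEntry_pos (h : SourceData SigS α β P) (hpos : ∀ m, 0 < α m * β m) (m : Fin M) :
    0 < piEntry α β P m := Real.sqrt_pos.2 (h.div_pos hpos m)

theorem piEntry_sq (h : SourceData SigS α β P) (hpos : ∀ m, 0 < α m * β m) (m : Fin M) :
    piEntry α β P m ^ 2 * (P * β m) = α m := by
  rw [piEntry, Real.sq_sqrt (h.div_pos hpos m).le]
  exact div_mul_cancel₀ _ (mul_ne_zero h.pos.ne' (right_ne_zero_of_mul (hpos m).ne'))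

theorem scaled_surjective (h : SourceData SigS α β P) (hpos : ∀ m, 0 < α m * β m)
    (v : Fin M → ℝ) : ∃ u, v = scaled α β P u := by
  refine ⟨fun m => piEntry α β P m / α m * v m, ?_⟩
  ext m
  have := h.ne_zero m
  have := (h.piEntry_pos hpos m).ne'
  simp only [scaled]
  field_simp

theorem PiMat_mulVec_scaled (h : SourceData SigS α β P) (hpos : ∀ m, 0 < α m * β m)
    (u : Fin M → ℝ) : PiMat α β P *ᵥ scaled α β P u = α * u := by
  ext m
  have := (h.piEntry_pos hpos m).ne'
  rw [PiMat, mulVec_diagonal]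
  change piEntry α β P m * (α m / piEntry α β P m * u m) = α m * u m
  field_simp

theorem isSymm_PiMat_conj (h : SourceData SigS α β P) :
    (PiMat α β P * SigS * PiMat α β P).IsSymm := by
  simp [Matrix.IsSymm, transpose_mul, h.isSymm.eq, PiMat, mul_assoc]

theorem scaled_quadForm (h : SourceData SigS α β P) (hpos : ∀ m, 0 < α m * β m)
    (u : Fin M → ℝ) :
    scaled α β P u ⬝ᵥ (PiMat α β P * SigS * PiMat α β P) *ᵥ scaled α β P u =
      (α * u) ⬝ᵥ SigS *ᵥ (α * u) := by
  have hT : (PiMat α β P)ᵀ = PiMat α β P := by simp [PiMat]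
  rw [mul_assoc, ← mulVec_mulVec, ← mulVec_mulVec, h.PiMat_mulVec_scaled hpos, dotProduct_mulVec,
    ← mulVec_transpose, hT, h.PiMat_mulVec_scaled hpos]

theorem scaled_dotProduct (h : SourceData SigS α β P) (hpos : ∀ m, 0 < α m * β m)
    (u w : Fin M → ℝ) :
    scaled α β P u ⬝ᵥ scaled α β P w = P * ∑ i, α i * β i * (u i * w i) := by
  rw [Finset.mul_sum]
  refine Finset.sum_congr rfl fun m _ => ?_
  have h1 := (h.piEntry_pos hpos m).ne'
  have h2 := h.piEntry_sq hpos m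
  simp only [scaled]
  have : α m / piEntry α β P m * (α m / piEntry α β P m) = P * (α m * β m) := by
    field_simp
    linear_combination (-α m) * h2
  linear_combination (u m * w m) * this

theorem mulVec_scaled_one (h : SourceData SigS α β P) (hpos : ∀ m, 0 < α m * β m) :
    (PiMat α β P * SigS * PiMat α β P) *ᵥ scaled α β P 1 = scaled α β P 1 := by
  rw [mul_assoc, ← mulVec_mulVec, ← mulVec_mulVec, h.PiMat_mulVec_scaled hpos, mul_one,
    h.mulVec_eq]
  ext m
  have h1 := (h.piEntry_pos hpos m).ne'
  have h2 := h.piEntry_sq hpos m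
  rw [PiMat, mulVec_diagonal]
  change piEntry α β P m * (P * β m) = α m / piEntry α β P m * 1
  field_simp
  linarith

theorem scaled_one_ne_zero (h : SourceData SigS α β P) (hpos : ∀ m, 0 < α m * β m) :
    scaled α β P 1 ≠ 0 := by
  intro h0
  have := h.scaled_dotProduct hpos 1 1
  simp only [h0, Pi.one_apply, mul_one, h.sum_eq_one, zero_dotProduct] at this
  exact h.pos.ne this

theorem largestEigOneMultOne_of_posSemidef (h : SourceData SigS α β P) {B : Fin M → ℝ}
    (hB : ∀ m, B m < P) (hpos : ∀ m, 0 < α m * β m)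
    (hpsd : (Sigma0 SigS α β P B).PosSemidef) :
    LargestEigOneMultOne (PiMat α β P * SigS * PiMat α β P) := by
  have hnorm : ∀ u, scaled α β P u ⬝ᵥ scaled α β P u = P * ∑ i, α i * β i * u i ^ 2 := by
    intro u
    rw [h.scaled_dotProduct hpos]
    simp only [sq]
  have hfix : ∀ v, (PiMat α β P * SigS * PiMat α β P) *ᵥ v = v →
      ∃ c : ℝ, v = c • scaled α β P 1 := by
    intro v hv
    obtain ⟨u, rfl⟩ := h.scaled_surjective hpos v
    have h1 := h.scaled_quadForm hpos u
    rw [hv, hnorm] at h1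
    have hconst := (h.quadForm_le_of_posSemidef hB hpos hpsd u).2 h1.symm
    rcases isEmpty_or_nonempty (Fin M) with hM | ⟨⟨m⟩⟩
    · exact ⟨0, Subsingleton.elim _ _⟩
    · refine ⟨u m, ?_⟩
      ext i
      simp only [scaled, hconst i m, Pi.smul_apply, smul_eq_mul, Pi.one_apply]
      ring
  refine ⟨⟨_, h.scaled_one_ne_zero hpos, h.mulVec_scaled_one hpos⟩, ?_, ?_⟩
  · intro μ v hv0 hv
    have hvv : 0 < v ⬝ᵥ v := by
      simpa using (dotProduct_star_self_pos_iff (v := v)).2 hv0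
    obtain ⟨u, rfl⟩ := h.scaled_surjective hpos v
    have h1 := (h.quadForm_le_of_posSemidef hB hpos hpsd u).1
    rw [← h.scaled_quadForm hpos, hv, ← hnorm, dotProduct_smul, smul_eq_mul] at h1
    exact le_of_mul_le_mul_right (by linarith) hvv
  · intro v w hv0 hv hw
    obtain ⟨a, rfl⟩ := hfix v hv
    obtain ⟨b, rfl⟩ := hfix w hw
    have ha : a ≠ 0 := by
      rintro rfl
      simp at hv0
    exact ⟨b / a, by rw [smul_smul, div_mul_cancel₀ _ ha]⟩

theorem posSemidef_of_eigenvalues_le (h : SourceData SigS α β P) (hpos : ∀ m, 0 < α m * β m)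
    (hA : (PiMat α β P * SigS * PiMat α β P).IsHermitian)
    (hone : ∀ v w : Fin M → ℝ, v ≠ 0 → (PiMat α β P * SigS * PiMat α β P) *ᵥ v = v →
      (PiMat α β P * SigS * PiMat α β P) *ᵥ w = w → ∃ c : ℝ, w = c • v)
    {l : ℝ} (hl : ∀ i, hA.eigenvalues i ≠ 1 → hA.eigenvalues i ≤ l)
    {B : Fin M → ℝ} (hB : ∀ m, l * P ≤ B m) : (Sigma0 SigS α β P B).PosSemidef := by
  rw [h.posSemidef_Sigma0_iff]
  intro u
  set c := ∑ k, α k * β k * u k with hc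
  set u' : Fin M → ℝ := fun i => u i - c with hu'
  have hmean : ∑ i, α i * β i * u' i = 0 := by
    simp only [hu', mul_sub, Finset.sum_sub_distrib, ← Finset.sum_mul, h.sum_eq_one, ← hc]
    ring
  have hbound := hA.dotProduct_mulVec_le l (scaled α β P u') (by
    intro i hi
    refine hl i fun h1 => hi ?_
    have he := hA.mulVec_eigenvectorBasis i
    rw [h1, one_smul] at he
    obtain ⟨b, hb⟩ := hone _ _ (h.scaled_one_ne_zero hpos) (h.mulVec_scaled_one hpos) he
    rw [hb, smul_dotProduct, h.scaled_dotProduct hpos]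
    simp [hmean])
  rw [h.scaled_quadForm hpos, h.scaled_dotProduct hpos] at hbound
  have hvar := sum_sum_mul_mul_sub_sq (fun i => α i * β i) h.sum_eq_one u'
  rw [hmean] at hvar
  have hle : l * P * (∑ i, ∑ j, α i * β i * (α j * β j) * (u' i - u' j) ^ 2) ≤
      ∑ i, ∑ j, α i * β i * (α j * β j) * B (max i j) * (u i - u j) ^ 2 := by
    simp only [Finset.mul_sum]
    refine Finset.sum_le_sum fun i _ => Finset.sum_le_sum fun j _ => ?_
    have h1 : u' i - u' j = u i - u j := by simp [hu']
    rw [h1]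
    have h2 := mul_le_mul_of_nonneg_right (hB (max i j)) (mul_nonneg
      (mul_pos (hpos i) (hpos j)).le (sq_nonneg (u i - u j)))
    linarith
  simp only [← sq] at hbound
  rw [hvar] at hle
  linarith

end SourceData

theorem le_mul_div_add_of_div_le {P l s : ℝ} (hP : 0 < P) (hl : l < 1) (hs : 0 < s)
    (h : l * P / (1 - l) ≤ s) : l * P ≤ P * s / (P + s) := by
  rw [div_le_iff₀ (by linarith)] at h
  rw [le_div_iff₀ (by linarith)]
  nlinarith

end Auxiliary

/-- Corollary 2: a matched channel (with decreasing positive noise powers)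
exists if and only if `α_m β_m > 0` for all `m` and `ΠΣ_SΠ` has largest eigenvalue `1`
with multiplicity `1`. Moreover, in that case every channel with
`σ²_{Z_1} ≥ … ≥ σ²_{Z_M} ≥ λ₂P/(1−λ₂)` is matched, where `λ₂` is the second largest
eigenvalue of `ΠΣ_SΠ`. -/
theorem stmt_7 {M : ℕ} (hM : 2 ≤ M)
    (SigS : Matrix (Fin M) (Fin M) ℝ) (hS : SigS.PosDef)
    (α : Fin M → ℝ) (hα : ∀ m, α m ≠ 0)
    (P : ℝ) (hP : P = α ⬝ᵥ (SigS *ᵥ α)) (hPpos : 0 < P)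
    (β : Fin M → ℝ) (hβ : β = fun m => (SigS *ᵥ α) m / P) :
    ((∃ σZ : Fin M → ℝ, (∀ i j : Fin M, i ≤ j → σZ j ≤ σZ i) ∧ (∀ m, 0 < σZ m) ∧
        Matched SigS α β P σZ) ↔
      ((∀ m, 0 < α m * β m) ∧
        LargestEigOneMultOne (PiMat α β P * SigS * PiMat α β P))) ∧
    ((∀ m, 0 < α m * β m) →
      LargestEigOneMultOne (PiMat α β P * SigS * PiMat α β P) →
      ∀ l2 : ℝ, IsSecondEig (PiMat α β P * SigS * PiMat α β P) l2 →
        ∀ σZ : Fin M → ℝ, (∀ i j : Fin M, i ≤ j → σZ j ≤ σZ i) → (∀ m, 0 < σZ m) →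
          (∀ m, l2 * P / (1 - l2) ≤ σZ m) → Matched SigS α β P σZ) := by
  have hsd : SourceData SigS α β P := by
    refine ⟨hS, hα, hPpos, ?_, ?_⟩
    · ext m
      simp only [hβ, Pi.smul_apply, smul_eq_mul]
      field_simp
    · simp only [hβ, ← mul_div_assoc, ← Finset.sum_div]
      change α ⬝ᵥ SigS *ᵥ α / P = 1
      rw [← hP, div_self hPpos.ne']
  have hA : (PiMat α β P * SigS * PiMat α β P).IsHermitian := by
    rw [Matrix.IsHermitian, conjTranspose_eq_transpose_of_trivial]
    exact hsd.isSymm_PiMat_conj.eq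
  have hne : ∀ i, (hA.eigenvectorBasis i).ofLp ≠ 0 := fun i h0 =>
    hA.eigenvectorBasis.orthonormal.ne_zero i (by ext j; exact congrFun h0 j)
  refine ⟨⟨?_, ?_⟩, ?_⟩
  · rintro ⟨σZ, -, hσ, hm⟩
    have hpos := hsd.mul_pos_of_posSemidef (B := fun m => P * σZ m / (P + σZ m))
      (fun m => by have := hσ m; positivity) hm
    refine ⟨hpos, hsd.largestEigOneMultOne_of_posSemidef (fun m => ?_) hpos hm⟩
    have := hσ m
    rw [div_lt_iff₀ (by linarith)]
    nlinarith
  · rintro ⟨hpos, -, hle, hone⟩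
    have : NeZero M := ⟨by omega⟩
    obtain ⟨k, hk⟩ := Finite.exists_max fun i : Fin M =>
      if hA.eigenvalues i = 1 then (1 / 2 : ℝ) else max (1 / 2) (hA.eigenvalues i)
    set l := if hA.eigenvalues k = 1 then (1 / 2 : ℝ) else max (1 / 2) (hA.eigenvalues k) with hldef
    have hl1 : l < 1 := by
      rw [hldef]
      split_ifs with h1
      · norm_num
      · exact max_lt (by norm_num)
          (lt_of_le_of_ne (hle _ _ (hne k) (hA.mulVec_eigenvectorBasis k)) h1)
    have hl0 : 0 < l := by
      rw [hldef]
      split_ifs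
      · norm_num
      · exact lt_max_of_lt_left (by norm_num)
    have hs : 0 < l * P / (1 - l) := _root_.div_pos (mul_pos hl0 hPpos) (sub_pos.2 hl1)
    refine ⟨fun _ => l * P / (1 - l), fun _ _ _ => le_rfl, fun _ => hs, ?_⟩
    refine hsd.posSemidef_of_eigenvalues_le hpos hA hone (l := l) (fun i hi => ?_)
      fun _ => le_mul_div_add_of_div_le hPpos hl1 hs le_rfl
    have := hk i
    simp only [if_neg hi] at this
    exact (le_max_right _ _).trans this
  · rintro hpos ⟨-, hle, hone⟩ l2 ⟨⟨v, hv0, hvort, hv⟩, hmax⟩ σZ - hσ hσl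
    have hl1 : l2 < 1 := by
      refine lt_of_le_of_ne (hle _ _ hv0 hv) ?_
      rintro rfl
      rw [one_smul] at hv
      exact hv0 (dotProduct_self_eq_zero.1 (hvort v hv))
    refine hsd.posSemidef_of_eigenvalues_le hpos hA hone (l := l2) (fun i hi => ?_)
      fun m => le_mul_div_add_of_div_le hPpos hl1 (hσ m) (hσl m)
    have he := hA.mulVec_eigenvectorBasis i
    refine hmax _ _ (hne i) (fun u hu => ?_) he
    have h1 := hsd.isSymm_PiMat_conj.dotProduct_mulVec_comm (hA.eigenvectorBasis i).ofLp u
    rw [hu, he, dotProduct_smul, smul_eq_mul, dotProduct_comm u] at h1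
    have h2 : (1 - hA.eigenvalues i) * ((hA.eigenvectorBasis i).ofLp ⬝ᵥ u) = 0 := by linarith
    exact (mul_eq_zero.1 h2).resolve_left (sub_ne_zero.2 (Ne.symm hi))
end

section
/- Let Σ_S be a symmetric positive definite M×M real matrix and ᾱ ∈ ℝ^M with not all of α_1,…,α_{M−1} equal to zero. Set P = ᾱᵀΣ_Sᾱ and β_M = (Σ_Sᾱ)_M / P. Then β_M²P < (Σ_S)_{M,M}. Moreover, if in addition all entries of diag(ᾱ)Σ_S diag(ᾱ) are strictly positive, then max_{j<M} β_jβ_M P / ρ_{j,M} > 1, where β_j = (Σ_Sᾱ)_j/P and ρ_{j,M} = (Σ_S)_{j,M}; in particular the threshold σ²_{Z*_M} = max_{j<M}(β_jβ_M/ρ_{j,M})P² − P is strictly positive. -/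
open Matrix BigOperators Finset

/-- Strict Cauchy–Schwarz for the inner product of a positive definite matrix, against a basis
vector `e k` not proportional to `x`. -/
theorem Matrix.PosDef.sq_mulVec_apply_lt {n : Type*} [Fintype n] [DecidableEq n]
    {A : Matrix n n ℝ} (hA : A.PosDef) {x : n → ℝ} {i k : n} (hik : i ≠ k) (hx : x i ≠ 0) :
    (A *ᵥ x) k ^ 2 < (x ⬝ᵥ (A *ᵥ x)) * A k k := by
  have hkk : 0 < A k k := hA.diag_pos
  set t : ℝ := (A *ᵥ x) k / A k k
  have htk : t * A k k = (A *ᵥ x) k := div_mul_cancel₀ _ hkk.ne'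
  have hne : x - t • Pi.single k (1 : ℝ) ≠ 0 := fun h => hx <| by
    simpa [hik] using congrFun h i
  have hpos := hA.dotProduct_mulVec_pos hne
  have hsymm : x ⬝ᵥ (A *ᵥ Pi.single k (1 : ℝ)) = (A *ᵥ x) k := by
    have hT : Aᵀ = A := by simpa using hA.isHermitian.eq
    rw [dotProduct_mulVec, dotProduct_single_one, ← mulVec_transpose, hT]
  have hcol : (A *ᵥ Pi.single k (1 : ℝ)) k = A k k := by simp
  simp only [star_trivial, mulVec_sub, mulVec_smul, sub_dotProduct, dotProduct_sub,
    smul_dotProduct, dotProduct_smul, smul_eq_mul, hsymm, single_one_dotProduct, hcol] at hpos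
  nlinarith [mul_pos hpos hkk]

/-- If all the terms `x i * x j * A i j` of the quadratic form are positive, then some off-diagonal
entry of column `k` is exceeded, in ratio, by the rank-one matrix built from `A *ᵥ x`. -/
theorem Matrix.PosDef.exists_one_lt_mulVec_mul_div {n : Type*} [Fintype n] [DecidableEq n]
    {A : Matrix n n ℝ} (hA : A.PosDef) {x : n → ℝ} {i k : n} (hik : i ≠ k)
    (hpos : ∀ i j, 0 < x i * x j * A i j) :
    ∃ j, j ≠ k ∧ 1 < (A *ᵥ x) j * (A *ᵥ x) k / ((x ⬝ᵥ (A *ᵥ x)) * A j k) := by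
  have hx : x i ≠ 0 := fun h => by simpa [h] using hpos i i
  have hxk : x k ≠ 0 := fun h => by simpa [h] using hpos k k
  have hstrict := hA.sq_mulVec_apply_lt hik hx
  set P := x ⬝ᵥ (A *ᵥ x)
  have hP : 0 < P := by
    simpa using hA.dotProduct_mulVec_pos (x := x) (fun h => hx (congrFun h i))
  by_contra! h
  have hterm : ∀ j, j ≠ k →
      (x j * (A *ᵥ x) j) * (x k * (A *ᵥ x) k) ≤ P * (x j * x k * A j k) := fun j hj => by
    have hA0 : A j k ≠ 0 := fun h0 => by simpa [h0] using hpos j k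
    have hle := mul_le_mul_of_nonneg_right (h j hj) (mul_pos hP (hpos j k)).le
    calc _ = (A *ᵥ x) j * (A *ᵥ x) k / (P * A j k) * (P * (x j * x k * A j k)) := by
          field_simp
      _ ≤ _ := by simpa using hle
  have hdiag : (x k * (A *ᵥ x) k) * (x k * (A *ᵥ x) k) < P * (x k * x k * A k k) := by
    nlinarith [mul_lt_mul_of_pos_left hstrict (pow_pos (abs_pos.mpr hxk) 2), sq_abs (x k)]
  have hsum : ∑ j, (x j * (A *ᵥ x) j) * (x k * (A *ᵥ x) k) < ∑ j, P * (x j * x k * A j k) := by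
    refine Finset.sum_lt_sum (fun j _ => ?_) ⟨k, Finset.mem_univ k, hdiag⟩
    rcases eq_or_ne j k with rfl | hj
    exacts [hdiag.le, hterm j hj]
  have hT (j : n) : A j k = A k j := by simpa using hA.isHermitian.apply k j
  have hcol : ∑ j, x j * x k * A j k = x k * (A *ᵥ x) k := by
    simp only [mulVec, dotProduct, Finset.mul_sum]
    exact Finset.sum_congr rfl fun j _ => by rw [hT]; ring
  rw [← Finset.sum_mul, ← Finset.mul_sum, hcol] at hsum
  exact lt_irrefl _ hsum

/-- the `reality check' remark after Corollary 3: with `Σ_S` positive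
definite and `α_1,…,α_{M−1}` not all zero, `β_M² P < (Σ_S)_{M,M}`; moreover if all entries
of `diag(ᾱ)Σ_S diag(ᾱ)` are strictly positive, then `max_{j<M} β_jβ_M P/ρ_{j,M} > 1`, and
in particular the threshold `σ²_{Z*_M} = max_{j<M}(β_jβ_M/ρ_{j,M})P² − P` is strictly
positive. -/
theorem stmt_10 {M : ℕ} (hM : 2 ≤ M)
    (SigS : Matrix (Fin M) (Fin M) ℝ) (hS : SigS.PosDef)
    (α : Fin M → ℝ)
    (hα : ∃ i : Fin M, i < ⟨M - 1, by omega⟩ ∧ α i ≠ 0)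
    (P : ℝ) (hP : P = α ⬝ᵥ (SigS *ᵥ α))
    (β : Fin M → ℝ) (hβ : β = fun m => (SigS *ᵥ α) m / P) :
    β ⟨M - 1, by omega⟩ ^ 2 * P < SigS ⟨M - 1, by omega⟩ ⟨M - 1, by omega⟩ ∧
    ((∀ i j : Fin M, 0 < α i * α j * SigS i j) →
      1 < (Finset.Iio (⟨M - 1, by omega⟩ : Fin M)).sup'
          ⟨⟨0, by omega⟩, by simp only [Finset.mem_Iio, Fin.mk_lt_mk]; omega⟩
          (fun j => β j * β ⟨M - 1, by omega⟩ * P / SigS j ⟨M - 1, by omega⟩) ∧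
      0 < (Finset.Iio (⟨M - 1, by omega⟩ : Fin M)).sup'
          ⟨⟨0, by omega⟩, by simp only [Finset.mem_Iio, Fin.mk_lt_mk]; omega⟩
          (fun j => β j * β ⟨M - 1, by omega⟩ / SigS j ⟨M - 1, by omega⟩) * P ^ 2 - P) := by
  obtain ⟨i, hi, hαi⟩ := hα
  have hP0 : 0 < P := by
    simpa [hP] using hS.dotProduct_mulVec_pos (x := α) (fun h => hαi (congrFun h i))
  have hcs := hS.sq_mulVec_apply_lt hi.ne hαi
  rw [← hP] at hcs
  subst hβ
  refine ⟨?_, fun hpos => ?_⟩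
  · rw [div_pow, sq P, ← div_div, div_mul_cancel₀ _ hP0.ne', div_lt_iff₀ hP0]
    linarith
  · obtain ⟨j, hj, hlt⟩ := hS.exists_one_lt_mulVec_mul_div hi.ne hpos
    rw [← hP] at hlt
    have hjlt : j ∈ Finset.Iio (⟨M - 1, by omega⟩ : Fin M) := by
      rw [Finset.mem_Iio, Fin.lt_def]
      have := Fin.val_ne_of_ne hj
      have := j.isLt
      simp only at *
      omega
    refine ⟨(Finset.lt_sup'_iff _).mpr ⟨j, hjlt, ?_⟩, ?_⟩
    · refine hlt.trans_eq ?_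
      field_simp
    · refine sub_pos.mpr (lt_of_lt_of_le ?_ (mul_le_mul_of_nonneg_right
        (Finset.le_sup' _ hjlt) (sq_nonneg P)))
      refine (lt_mul_of_one_lt_left hP0 hlt).trans_eq ?_
      field_simp
end

section
/- Let M ≥ 2, σ²_S > 0, 0 < ρ < 1, and consider the symmetric source covariance Σ_S with (Σ_S)_{ii} = σ²_S and (Σ_S)_{ij} = ρσ²_S for i ≠ j (which is positive definite), and equal coefficients α_1 = … = α_M = α ≠ 0. Then P = ᾱᵀΣ_Sᾱ = α²Mσ²_S(1+(M−1)ρ) and β_m = 1/(αM) for all m, and the channel with noise powers σ²_{Z_1} ≥ … ≥ σ²_{Z_M} > 0 is matched (Σ^{(0)} ⪰ 0) if and only if σ²_{Z_M}/(P+σ²_{Z_M}) ≥ (1−ρ)/(1+(M−1)ρ). -/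
open Matrix BigOperators Finset

/-- The weighted Laplacian quadratic form as a sum of squares. -/
theorem dotProduct_laplacian_mulVec {n : Type*} [Fintype n] [DecidableEq n] (w : n → n → ℝ)
    (hw : ∀ i j, w i j = w j i) (x : n → ℝ) :
    x ⬝ᵥ ((diagonal (fun i => ∑ j, w i j) - Matrix.of w) *ᵥ x) =
      (∑ i, ∑ j, w i j * (x i - x j) ^ 2) / 2 := by
  have hswap : ∑ i, ∑ j, w i j * x j ^ 2 = ∑ i, ∑ j, w i j * x i ^ 2 := by
    rw [Finset.sum_comm]
    simp_rw [fun i j => hw j i]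
  have hexp : ∑ i, ∑ j, w i j * (x i - x j) ^ 2 =
      ∑ i, ∑ j, w i j * x i ^ 2 + ∑ i, ∑ j, w i j * x j ^ 2
        - 2 * ∑ i, ∑ j, w i j * x i * x j := by
    simp only [Finset.mul_sum, ← Finset.sum_add_distrib, ← Finset.sum_sub_distrib]
    exact Finset.sum_congr rfl fun i _ => Finset.sum_congr rfl fun j _ => by ring
  have hform : x ⬝ᵥ ((diagonal (fun i => ∑ j, w i j) - Matrix.of w) *ᵥ x) =
      ∑ i, ∑ j, w i j * x i ^ 2 - ∑ i, ∑ j, w i j * x i * x j := by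
    rw [sub_mulVec, dotProduct_sub]
    congr 1
    · simp only [dotProduct, mulVec_diagonal]
      exact Finset.sum_congr rfl fun i _ => by rw [← Finset.sum_mul]; ring
    · refine Finset.sum_congr rfl fun i _ => ?_
      simp only [mulVec, dotProduct, Matrix.of_apply, Finset.mul_sum]
      exact Finset.sum_congr rfl fun j _ => by ring
  rw [hform, hexp, hswap]
  ring

/-- A weighted Laplacian with nonnegative symmetric weights is positive semidefinite. -/
theorem posSemidef_laplacian {n : Type*} [Fintype n] [DecidableEq n] (w : n → n → ℝ)
    (hw : ∀ i j, w i j = w j i) (h0 : ∀ i j, 0 ≤ w i j) :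
    (diagonal (fun i => ∑ j, w i j) - Matrix.of w).PosSemidef := by
  refine PosSemidef.of_dotProduct_mulVec_nonneg ?_ fun x => ?_
  · refine (isHermitian_diagonal _).sub ?_
    ext i j
    simp [hw j i]
  · rw [star_trivial, dotProduct_laplacian_mulVec w hw]
    have := Finset.sum_nonneg fun i (_ : i ∈ Finset.univ) =>
      Finset.sum_nonneg fun j (_ : j ∈ Finset.univ) => mul_nonneg (h0 i j) (sq_nonneg (x i - x j))
    positivity

theorem posSemidef_laplacian_max_iff {M : ℕ} (hM : 2 ≤ M) (f : Fin M → ℝ) (m : Fin M)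
    (hm : ∀ i, i ≤ m) (hf : ∀ i, f m ≤ f i) :
    (diagonal (fun i => ∑ j, f (max i j)) - Matrix.of fun i j => f (max i j)).PosSemidef ↔
      0 ≤ f m := by
  constructor
  · intro h
    have hd := h.diag_nonneg (i := m)
    have hM' : (2 : ℝ) ≤ M := by exact_mod_cast hM
    simp only [Matrix.sub_apply, diagonal_apply_eq, Matrix.of_apply, max_self,
      max_eq_left (hm _), Finset.sum_const, Finset.card_univ, Fintype.card_fin,
      nsmul_eq_mul] at hd
    nlinarith
  · intro h
    exact posSemidef_laplacian (fun i j => f (max i j)) (fun i j => by rw [max_comm])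
      fun i j => h.trans (hf _)

theorem sum_max_eq {M : ℕ} (f : Fin M → ℝ) (i : Fin M) :
    ∑ j, f (max i j) = (i : ℝ) * f i + f i + ∑ j ∈ Finset.Ioi i, f j := by
  have hlt : ∑ j ∈ Finset.univ.filter (fun j => j < i), f (max i j) = (i : ℝ) * f i := by
    rw [Finset.sum_congr rfl fun j hj => by rw [max_eq_left (Finset.mem_filter.1 hj).2.le],
      Finset.sum_const, Finset.filter_gt_eq_Iio, Fin.card_Iio, nsmul_eq_mul]
  have hge : Finset.univ.filter (fun j => ¬ j < i) = insert i (Finset.Ioi i) := by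
    ext j
    simp [le_iff_eq_or_lt, eq_comm (a := i)]
  rw [← Finset.sum_filter_add_sum_filter_not Finset.univ (fun j => j < i), hlt, hge,
    Finset.sum_insert (by simp), max_self, add_assoc]
  congr 2
  exact Finset.sum_congr rfl fun j hj => by rw [max_eq_right (Finset.mem_Ioi.1 hj).le]

/-- In the symmetric case `Σ^{(0)}` is a weighted Laplacian. -/
theorem Sigma0_eq_laplacian {M : ℕ} (hM : 2 ≤ M) (σS ρ a P : ℝ) (ha : a ≠ 0)
    (hP : P = a ^ 2 * (M : ℝ) * σS * (1 + ((M : ℝ) - 1) * ρ)) (B : Fin M → ℝ)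
    (f : Fin M → ℝ) (hf : f = fun i => B i / (a * M) ^ 2 - σS * (1 - ρ) / M) :
    Sigma0 (Matrix.of fun i j => if i = j then σS else ρ * σS) (fun _ => a)
        (fun _ => 1 / (a * (M : ℝ))) P B =
      diagonal (fun i => ∑ j, f (max i j)) - Matrix.of fun i j => f (max i j) := by
  have hM0 : (M : ℝ) ≠ 0 := by positivity
  ext i j
  by_cases hij : i = j
  · subst hij
    have hcard : ((Finset.Ioi i).card : ℝ) = (M : ℝ) - 1 - i := by
      rw [Fin.card_Ioi, Nat.cast_sub (by omega), Nat.cast_sub (by omega), Nat.cast_one]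
    simp only [Sigma0, SigmaV, Matrix.add_apply, Matrix.sub_apply, Matrix.smul_apply,
      Matrix.of_apply, vecMulVec_apply, if_true, diagonal_apply_eq, max_self, smul_eq_mul,
      sum_max_eq, Finset.sum_const, Fin.card_Iio, nsmul_eq_mul, ← Finset.mul_sum]
    rw [hf]
    simp only [Finset.sum_sub_distrib, Finset.sum_const, nsmul_eq_mul, hcard, hP,
      ← Finset.sum_div]
    field_simp
    ring
  · simp only [Sigma0, SigmaV, Matrix.add_apply, Matrix.sub_apply, Matrix.smul_apply,
      Matrix.of_apply, vecMulVec_apply, if_neg hij, diagonal_apply_ne _ hij, smul_eq_mul, hf, hP]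
    field_simp
    ring

/-- symmetric-case remark after Corollary 3: for the symmetric source
`(Σ_S)_{ii} = σ²_S`, `(Σ_S)_{ij} = ρσ²_S` (`0 < ρ < 1`) and equal coefficients
`α_m = a ≠ 0`, we have `P = a²Mσ²_S(1+(M−1)ρ)`, `β_m = 1/(aM)`, and a channel with
decreasing positive noise powers is matched if and only if
`σ²_{Z_M}/(P+σ²_{Z_M}) ≥ (1−ρ)/(1+(M−1)ρ)`. -/
theorem stmt_11 {M : ℕ} (hM : 2 ≤ M)
    (σS ρ : ℝ) (hσS : 0 < σS) (hρ0 : 0 < ρ) (hρ1 : ρ < 1)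
    (a : ℝ) (ha : a ≠ 0)
    (SigS : Matrix (Fin M) (Fin M) ℝ)
    (hSigS : SigS = Matrix.of fun i j => if i = j then σS else ρ * σS)
    (α : Fin M → ℝ) (hα : α = fun _ => a)
    (P : ℝ) (hP : P = α ⬝ᵥ (SigS *ᵥ α))
    (β : Fin M → ℝ) (hβ : β = fun m => (SigS *ᵥ α) m / P) :
    P = a ^ 2 * (M : ℝ) * σS * (1 + ((M : ℝ) - 1) * ρ) ∧
    (∀ m, β m = 1 / (a * (M : ℝ))) ∧
    (∀ σZ : Fin M → ℝ, (∀ i j : Fin M, i ≤ j → σZ j ≤ σZ i) → (∀ m, 0 < σZ m) →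
      ((Sigma0 SigS α β P (fun m => P * σZ m / (P + σZ m))).PosSemidef ↔
        (1 - ρ) / (1 + ((M : ℝ) - 1) * ρ) ≤
          σZ ⟨M - 1, by omega⟩ / (P + σZ ⟨M - 1, by omega⟩))) := by
  have hM2 : (2 : ℝ) ≤ M := by exact_mod_cast hM
  have hM0 : (M : ℝ) ≠ 0 := by positivity
  have hQ : 0 < 1 + ((M : ℝ) - 1) * ρ := by nlinarith
  have hmul : ∀ m, (SigS *ᵥ α) m = a * σS * (1 + ((M : ℝ) - 1) * ρ) := by
    intro m
    have hentry : ∀ j, SigS m j * α j = (if m = j then a * σS * (1 - ρ) else 0) + a * ρ * σS := by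
      intro j
      rw [hSigS, hα, Matrix.of_apply]
      split_ifs <;> ring
    simp only [mulVec, dotProduct, hentry, Finset.sum_add_distrib, Finset.sum_ite_eq,
      Finset.mem_univ, if_true, Finset.sum_const, Finset.card_univ, Fintype.card_fin, nsmul_eq_mul]
    ring
  have hPval : P = a ^ 2 * (M : ℝ) * σS * (1 + ((M : ℝ) - 1) * ρ) := by
    have hdot : P = ∑ m, α m * (SigS *ᵥ α) m := hP
    simp only [hmul] at hdot
    simp only [hdot, hα, Finset.sum_const, Finset.card_univ, Fintype.card_fin,
      nsmul_eq_mul]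
    ring
  have hPpos : 0 < P := by rw [hPval]; positivity
  have hβval : ∀ m, β m = 1 / (a * (M : ℝ)) := by
    intro m
    simp only [hβ, hmul, hPval]
    field_simp
  refine ⟨hPval, hβval, fun σZ hanti hpos => ?_⟩
  set m : Fin M := ⟨M - 1, by omega⟩ with hm_def
  have hm : ∀ i, i ≤ m := fun i => Fin.le_def.2 (by simp only [hm_def]; omega)
  have hB : ∀ i, P * σZ m / (P + σZ m) ≤ P * σZ i / (P + σZ i) := by
    intro i
    have h1 := hpos m
    have h2 := hpos i
    rw [div_le_div_iff₀ (by positivity) (by positivity)]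
    nlinarith [mul_le_mul_of_nonneg_left (hanti i m (hm i)) (sq_nonneg P)]
  rw [hSigS, hα, funext hβval, Sigma0_eq_laplacian hM σS ρ a P ha hPval _ _ rfl]
  refine (posSemidef_laplacian_max_iff hM
    (fun i => P * σZ i / (P + σZ i) / (a * M) ^ 2 - σS * (1 - ρ) / M) m hm
    fun i => by have := hB i; gcongr ?_ / _ - _).trans ?_
  have hval : P * σZ m / (P + σZ m) / (a * M) ^ 2 - σS * (1 - ρ) / M =
      σS / M * (σZ m / (P + σZ m) * (1 + ((M : ℝ) - 1) * ρ) - (1 - ρ)) := by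
    rw [mul_div_assoc, mul_comm P, mul_div_assoc]
    have : P / (a * M) ^ 2 = σS * (1 + ((M : ℝ) - 1) * ρ) / M := by
      rw [hPval]
      field_simp
    rw [this]
    ring
  rw [hval, mul_nonneg_iff_of_pos_left (by positivity), sub_nonneg, div_le_iff₀ hQ]
end

section
/- Let Σ_S be the 3×3 matrix with rows (1, ρ₁, ρ₂), (ρ₁, 1, ρ₁), (ρ₂, ρ₁, 1), assumed positive definite, let ᾱ = (1,1,1)ᵀ, P = ᾱᵀΣ_Sᾱ, β̄ = (1/P)Σ_Sᾱ, and assume β_m > 0 for all m so that Π = diag(√(1/(Pβ_1)), √(1/(Pβ_2)), √(1/(Pβ_3))) is well defined. Then the eigenvalues of ΠΣ_SΠ are exactly λ₁ = 1, λ₂ = (−2ρ₁² + ρ₂ + 1)/(2ρ₁² + 2ρ₁ρ₂ + 3ρ₁ + ρ₂ + 1), and λ₃ = (1−ρ₂)/(ρ₁ + ρ₂ + 1). -/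
open Matrix BigOperators Finset

/-- The eigenvalues of a square matrix over a field are the zeros of `μ ↦ det (A - μ)`. -/
theorem exists_mulVec_eq_smul_iff_det_sub_eq_zero {n K : Type*} [Fintype n] [DecidableEq n]
    [Field K] (A : Matrix n n K) (μ : K) :
    (∃ v : n → K, v ≠ 0 ∧ A *ᵥ v = μ • v) ↔ (A - μ • (1 : Matrix n n K)).det = 0 := by
  rw [← Matrix.exists_mulVec_eq_zero_iff]
  simp only [Matrix.sub_mulVec, Matrix.smul_mulVec, Matrix.one_mulVec, sub_eq_zero]

/-- three-component example: for the 3×3 source covariance with rows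
`(1,ρ₁,ρ₂), (ρ₁,1,ρ₁), (ρ₂,ρ₁,1)` (positive definite), `ᾱ = (1,1,1)ᵀ`,
`P = ᾱᵀΣ_Sᾱ`, `β̄ = (1/P)Σ_Sᾱ` with `β_m > 0`, the eigenvalues of `ΠΣ_SΠ` are exactly
`1`, `λ₂ = (−2ρ₁² + ρ₂ + 1)/(2ρ₁² + 2ρ₁ρ₂ + 3ρ₁ + ρ₂ + 1)` and
`λ₃ = (1−ρ₂)/(ρ₁ + ρ₂ + 1)`. -/
theorem stmt_12 (ρ₁ ρ₂ : ℝ)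
    (SigS : Matrix (Fin 3) (Fin 3) ℝ)
    (hSigS : SigS = Matrix.of ![![1, ρ₁, ρ₂], ![ρ₁, 1, ρ₁], ![ρ₂, ρ₁, 1]])
    (hS : SigS.PosDef)
    (α : Fin 3 → ℝ) (hα : α = ![1, 1, 1])
    (P : ℝ) (hP : P = α ⬝ᵥ (SigS *ᵥ α))
    (β : Fin 3 → ℝ) (hβ : β = fun m => (SigS *ᵥ α) m / P)
    (hβpos : ∀ m, 0 < β m) :
    ∀ μ : ℝ,
      (∃ v : Fin 3 → ℝ, v ≠ 0 ∧
        (Matrix.diagonal (fun m => Real.sqrt (α m / (P * β m))) * SigS *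
          Matrix.diagonal (fun m => Real.sqrt (α m / (P * β m)))) *ᵥ v = μ • v) ↔
      (μ = 1 ∨
       μ = (-2 * ρ₁ ^ 2 + ρ₂ + 1) / (2 * ρ₁ ^ 2 + 2 * ρ₁ * ρ₂ + 3 * ρ₁ + ρ₂ + 1) ∨
       μ = (1 - ρ₂) / (ρ₁ + ρ₂ + 1)) := by
  intro μ
  have hαne : α ≠ 0 := fun h => by simpa [hα] using congrFun h 0
  have hPpos : 0 < P := by
    rw [hP]
    simpa using hS.dotProduct_mulVec_pos hαne
  have hPβ : ∀ m, P * β m = (SigS *ᵥ α) m := fun m => by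
    rw [hβ]
    exact mul_div_cancel₀ _ hPpos.ne'
  have hmul : SigS *ᵥ α = ![ρ₁ + ρ₂ + 1, 2 * ρ₁ + 1, ρ₁ + ρ₂ + 1] := by
    subst hSigS hα
    ext i
    fin_cases i <;> simp [Matrix.mulVec, dotProduct, Fin.sum_univ_three] <;> ring
  have hs : 0 < ρ₁ + ρ₂ + 1 := by
    simpa [hPβ, hmul] using mul_pos hPpos (hβpos 0)
  have ht : 0 < 2 * ρ₁ + 1 := by
    simpa [hPβ, hmul] using mul_pos hPpos (hβpos 1)
  obtain ⟨p, hp⟩ : ∃ p, p = √(1 / (ρ₁ + ρ₂ + 1)) := ⟨_, rfl⟩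
  obtain ⟨q, hq⟩ : ∃ q, q = √(1 / (2 * ρ₁ + 1)) := ⟨_, rfl⟩
  have hp2 : p ^ 2 = 1 / (ρ₁ + ρ₂ + 1) := by rw [hp, Real.sq_sqrt (by positivity)]
  have hq2 : q ^ 2 = 1 / (2 * ρ₁ + 1) := by rw [hq, Real.sq_sqrt (by positivity)]
  have hdiag : (fun m => √(α m / (P * β m))) = ![p, q, p] := by
    ext i
    rw [hPβ, hmul, hα, hp, hq]
    fin_cases i <;> simp
  have hdet : (Matrix.diagonal ![p, q, p] * SigS * Matrix.diagonal ![p, q, p]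
      - μ • (1 : Matrix (Fin 3) (Fin 3) ℝ)).det =
      (p ^ 2 - μ) ^ 2 * (q ^ 2 - μ) + 2 * ρ₁ ^ 2 * ρ₂ * (p ^ 2) ^ 2 * q ^ 2
        - 2 * ρ₁ ^ 2 * p ^ 2 * q ^ 2 * (p ^ 2 - μ) - ρ₂ ^ 2 * (p ^ 2) ^ 2 * (q ^ 2 - μ) := by
    rw [Matrix.det_fin_three, hSigS]
    simp [Matrix.mul_diagonal, Matrix.diagonal_mul]
    ring
  have hden : 2 * ρ₁ ^ 2 + 2 * ρ₁ * ρ₂ + 3 * ρ₁ + ρ₂ + 1 = (ρ₁ + ρ₂ + 1) * (2 * ρ₁ + 1) := by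
    ring
  have hfactor : (Matrix.diagonal ![p, q, p] * SigS * Matrix.diagonal ![p, q, p]
      - μ • (1 : Matrix (Fin 3) (Fin 3) ℝ)).det =
      -((μ - 1) * ((μ - (-2 * ρ₁ ^ 2 + ρ₂ + 1) / ((ρ₁ + ρ₂ + 1) * (2 * ρ₁ + 1)))
        * (μ - (1 - ρ₂) / (ρ₁ + ρ₂ + 1)))) := by
    rw [hdet, hp2, hq2]
    obtain ⟨s, hs_eq⟩ : ∃ s, s = ρ₁ + ρ₂ + 1 := ⟨_, rfl⟩
    obtain ⟨t, ht_eq⟩ : ∃ t, t = 2 * ρ₁ + 1 := ⟨_, rfl⟩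
    rw [← hs_eq] at hs ⊢
    rw [← ht_eq] at ht ⊢
    obtain rfl : ρ₁ = (t - 1) / 2 := by linarith
    obtain rfl : ρ₂ = s - 1 - (t - 1) / 2 := by linarith
    field_simp
    ring
  rw [exists_mulVec_eq_smul_iff_det_sub_eq_zero, hdiag, hfactor, hden, neg_eq_zero, mul_eq_zero,
    mul_eq_zero, sub_eq_zero, sub_eq_zero, sub_eq_zero]
end

section
/- Let Σ_S be the 3×3 matrix with rows (1, ρ₁, ρ₂), (ρ₁, 1, ρ₁), (ρ₂, ρ₁, 1) and ᾱ = (1,1,1)ᵀ, β̄ = (1/P)Σ_Sᾱ with P = ᾱᵀΣ_Sᾱ, and let λ₂ = (−2ρ₁² + ρ₂ + 1)/(2ρ₁² + 2ρ₁ρ₂ + 3ρ₁ + ρ₂ + 1) and λ₃ = (1−ρ₂)/(ρ₁ + ρ₂ + 1). Then the conditions [Σ_S is positive definite, β_m > 0 for m = 1,2,3, 0 < λ₂ < 1, and 0 < λ₃ < 1] hold if and only if ρ₂ < 1, 0 < ρ₁ < 1, ρ₁ + 2ρ₂ > 0, and ρ₂ > 2ρ₁² − 1. -/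
open Matrix BigOperators Finset

/-- A symmetric Toeplitz matrix of size three with unit diagonal is positive definite iff its
form, diagonalized in `x₁ + ρ₁ (x₀ + x₂)`, `x₀ + x₂` and `x₀ - x₂`, has positive coefficients. -/
theorem posDef_toeplitz_three_iff (a b : ℝ) :
    (Matrix.of ![![1, a, b], ![a, 1, a], ![b, a, 1]] : Matrix (Fin 3) (Fin 3) ℝ).PosDef ↔
      b < 1 ∧ 2 * a ^ 2 - 1 < b := by
  have form (x : Fin 3 → ℝ) :
      star x ⬝ᵥ ((Matrix.of ![![1, a, b], ![a, 1, a], ![b, a, 1]] :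
        Matrix (Fin 3) (Fin 3) ℝ) *ᵥ x) =
      (x 1 + a * (x 0 + x 2)) ^ 2 + ((1 + b) / 2 - a ^ 2) * (x 0 + x 2) ^ 2 +
        (1 - b) / 2 * (x 0 - x 2) ^ 2 := by
    simp [dotProduct, mulVec, Fin.sum_univ_three]
    ring
  constructor
  · intro h
    have h₁ := h.dotProduct_mulVec_pos (x := ![1, 0, -1]) (by simp)
    have h₂ := h.dotProduct_mulVec_pos (x := ![1, -2 * a, 1]) (by simp)
    rw [form] at h₁ h₂
    simp at h₁ h₂
    constructor <;> nlinarith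
  · rintro ⟨hb, hab⟩
    refine Matrix.PosDef.of_dotProduct_mulVec_pos ?_ fun x hx => ?_
    · ext i j
      fin_cases i <;> fin_cases j <;> simp
    · rw [form]
      have hs : 0 < (1 + b) / 2 - a ^ 2 := by linarith
      have hd : 0 < (1 - b) / 2 := by linarith
      by_cases h₁ : x 0 + x 2 = 0
      · by_cases h₂ : x 0 - x 2 = 0
        · have h0 : x 0 = 0 := by linarith
          have h2 : x 2 = 0 := by linarith
          have h1 : x 1 ≠ 0 := by
            intro h1
            apply hx
            ext i
            fin_cases i <;> simp [h0, h1, h2]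
          simp only [h0, h2]
          ring_nf
          positivity
        · positivity
      · positivity

/-- equation (source2): for the 3×3 source covariance with rows
`(1,ρ₁,ρ₂), (ρ₁,1,ρ₁), (ρ₂,ρ₁,1)`, `ᾱ = (1,1,1)ᵀ`, `P = ᾱᵀΣ_Sᾱ`, `β̄ = (1/P)Σ_Sᾱ`,
`λ₂ = (−2ρ₁²+ρ₂+1)/(2ρ₁²+2ρ₁ρ₂+3ρ₁+ρ₂+1)` and `λ₃ = (1−ρ₂)/(ρ₁+ρ₂+1)`, the conditions
[`Σ_S` positive definite, `β_m > 0`, `0 < λ₂ < 1`, `0 < λ₃ < 1`] hold if and only if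
`ρ₂ < 1`, `0 < ρ₁ < 1`, `ρ₁ + 2ρ₂ > 0` and `ρ₂ > 2ρ₁² − 1`. -/
theorem stmt_13 (ρ₁ ρ₂ : ℝ)
    (SigS : Matrix (Fin 3) (Fin 3) ℝ)
    (hSigS : SigS = Matrix.of ![![1, ρ₁, ρ₂], ![ρ₁, 1, ρ₁], ![ρ₂, ρ₁, 1]])
    (α : Fin 3 → ℝ) (hα : α = ![1, 1, 1])
    (P : ℝ) (hP : P = α ⬝ᵥ (SigS *ᵥ α))
    (β : Fin 3 → ℝ) (hβ : β = fun m => (SigS *ᵥ α) m / P)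
    (l2 l3 : ℝ)
    (hl2 : l2 = (-2 * ρ₁ ^ 2 + ρ₂ + 1) / (2 * ρ₁ ^ 2 + 2 * ρ₁ * ρ₂ + 3 * ρ₁ + ρ₂ + 1))
    (hl3 : l3 = (1 - ρ₂) / (ρ₁ + ρ₂ + 1)) :
    (SigS.PosDef ∧ (∀ m, 0 < β m) ∧ 0 < l2 ∧ l2 < 1 ∧ 0 < l3 ∧ l3 < 1) ↔
      (ρ₂ < 1 ∧ 0 < ρ₁ ∧ ρ₁ < 1 ∧ 0 < ρ₁ + 2 * ρ₂ ∧ 2 * ρ₁ ^ 2 - 1 < ρ₂) := by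
  subst hSigS hα hP hβ hl2 hl3
  rw [posDef_toeplitz_three_iff, Fin.forall_fin_succ, Fin.forall_fin_succ, Fin.forall_fin_one]
  have hden : 2 * ρ₁ ^ 2 + 2 * ρ₁ * ρ₂ + 3 * ρ₁ + ρ₂ + 1 = (2 * ρ₁ + 1) * (ρ₁ + ρ₂ + 1) := by
    ring
  simp only [hden, dotProduct, mulVec, Fin.sum_univ_three, of_apply, Matrix.cons_val]
  constructor
  · rintro ⟨⟨hb, hab⟩, -, hl2, hl2', hl3, hl3'⟩
    have hnum : 0 < -2 * ρ₁ ^ 2 + ρ₂ + 1 := by linarith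
    have hD := (div_pos_iff_of_pos_left hnum).1 hl2
    have hE := (div_pos_iff_of_pos_left (sub_pos.2 hb)).1 hl3
    rw [div_lt_one hD] at hl2'
    rw [div_lt_one hE] at hl3'
    have hF : 0 < 2 * ρ₁ + 1 := pos_of_mul_pos_left hD hE.le
    have hP : 0 < 4 * ρ₁ + 2 * ρ₂ + 3 := by linarith
    have hρ : 0 < ρ₁ := by
      refine pos_of_mul_pos_left (b := 4 * ρ₁ + 2 * ρ₂ + 3) ?_ hP.le
      linarith
    exact ⟨hb, hρ, by nlinarith, by linarith, hab⟩
  · rintro ⟨hb, hρ, hρ', hs, hab⟩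
    have hE : 0 < ρ₁ + ρ₂ + 1 := by linarith
    have hD : 0 < (2 * ρ₁ + 1) * (ρ₁ + ρ₂ + 1) := by positivity
    refine ⟨⟨hb, hab⟩, ⟨?_, ?_, ?_⟩, div_pos (by linarith) hD, (div_lt_one hD).2 ?_,
      div_pos (by linarith) hE, (div_lt_one hE).2 (by linarith)⟩
    · apply div_pos <;> simp <;> linarith
    · apply div_pos <;> simp <;> linarith
    · apply div_pos <;> simp <;> linarith
    · have hP : 0 < ρ₁ * (4 * ρ₁ + 2 * ρ₂ + 3) := mul_pos hρ (by linarith)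
      linarith
end

section
/- Let L ≥ 2, σ²_S > 0, σ²_{Z'} > 0, d_ℓ > 0, P_ℓ > 0, δ_ℓ > 0 for ℓ = 1,…,L, and let Σ_T be the L×L matrix with entries ψ_{ℓ,ℓ'} = d_ℓ d_{ℓ'} σ²_S + [ℓ=ℓ'] σ²_{Z'}. Then the row vector (δ_1√(P_1/ψ_{1,1}), …, δ_L√(P_L/ψ_{L,L})) Σ_T is proportional to (d_1, …, d_L) (i.e. the ratio of the ℓ-th component to d_ℓ is independent of ℓ) if and only if the quantity P_ℓ δ_ℓ² / ((d_ℓ² σ²_S + σ²_{Z'}) d_ℓ²) is the same for all ℓ = 1,…,L. -/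
open Matrix BigOperators Finset

/-- scalar Gaussian CEO case of Theorem 2: with sensor observation
covariance `ψ_{ℓ,ℓ'} = d_ℓ d_{ℓ'} σ²_S + [ℓ=ℓ'] σ²_{Z'}`, the row vector
`(δ_1√(P_1/ψ_{1,1}), …, δ_L√(P_L/ψ_{L,L})) Σ_T` is proportional to `(d_1,…,d_L)` if and
only if `P_ℓ δ_ℓ² / ((d_ℓ² σ²_S + σ²_{Z'}) d_ℓ²)` is the same for all `ℓ`. -/
theorem stmt_15 {L : ℕ} (hL : 2 ≤ L)
    (σS σZ' : ℝ) (hσS : 0 < σS) (hσZ' : 0 < σZ')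
    (d Pl δ : Fin L → ℝ) (hd : ∀ ℓ, 0 < d ℓ) (hPl : ∀ ℓ, 0 < Pl ℓ) (hδ : ∀ ℓ, 0 < δ ℓ)
    (SigT : Matrix (Fin L) (Fin L) ℝ)
    (hSigT : SigT = Matrix.of fun ℓ ℓ' => d ℓ * d ℓ' * σS + if ℓ = ℓ' then σZ' else 0)
    (v : Fin L → ℝ) (hv : v = fun ℓ => δ ℓ * Real.sqrt (Pl ℓ / SigT ℓ ℓ)) :
    (∃ cst : ℝ, ∀ ℓ, (v ᵥ* SigT) ℓ = cst * d ℓ) ↔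
      (∃ k : ℝ, ∀ ℓ, Pl ℓ * δ ℓ ^ 2 / ((d ℓ ^ 2 * σS + σZ') * d ℓ ^ 2) = k) := by
  have hmul : ∀ ℓ, (v ᵥ* SigT) ℓ = (∑ i, v i * d i) * σS * d ℓ + v ℓ * σZ' := by
    intro ℓ
    simp only [hSigT, Matrix.vecMul, dotProduct, Matrix.of_apply, mul_add, Finset.sum_add_distrib,
      mul_ite, mul_zero, Finset.sum_ite_eq', Finset.mem_univ, if_true,
      Finset.sum_mul]
    congr 1
    exact Finset.sum_congr rfl fun i _ => by ring
  have hv_nonneg : ∀ ℓ, 0 ≤ v ℓ := fun ℓ => by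
    rw [hv]
    exact mul_nonneg (hδ ℓ).le (Real.sqrt_nonneg _)
  have hsq : ∀ ℓ, Pl ℓ * δ ℓ ^ 2 / ((d ℓ ^ 2 * σS + σZ') * d ℓ ^ 2) = (v ℓ / d ℓ) ^ 2 := by
    intro ℓ
    have hψ : SigT ℓ ℓ = d ℓ ^ 2 * σS + σZ' := by
      simp [hSigT, sq]
    have hψ_pos : 0 < d ℓ ^ 2 * σS + σZ' := by
      have := hd ℓ
      positivity
    have hvsq : v ℓ ^ 2 = δ ℓ ^ 2 * (Pl ℓ / (d ℓ ^ 2 * σS + σZ')) := by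
      simp only [hv, hψ, mul_pow]
      rw [Real.sq_sqrt (div_pos (hPl ℓ) hψ_pos).le]
    have hd_ne := (hd ℓ).ne'
    rw [div_pow, hvsq]
    field_simp
  simp only [hmul, hsq]
  constructor
  · rintro ⟨cst, h⟩
    refine ⟨((cst - (∑ i, v i * d i) * σS) / σZ') ^ 2, fun ℓ => ?_⟩
    congr 1
    rw [div_eq_div_iff (hd ℓ).ne' hσZ'.ne']
    linear_combination h ℓ
  · rintro ⟨k, h⟩
    refine ⟨(∑ i, v i * d i) * σS + Real.sqrt k * σZ', fun ℓ => ?_⟩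
    have hvd : v ℓ = Real.sqrt k * d ℓ := by
      rw [← div_eq_iff (hd ℓ).ne', ← h ℓ, Real.sqrt_sq (div_nonneg (hv_nonneg ℓ) (hd ℓ).le)]
    linear_combination σZ' * hvd
end

section
/- Let M ≥ 2, let ᾱ, β̄ ∈ ℝ^M with α_m ≠ 0 for all m, let B_1 ≥ … ≥ B_M > 0, and assume α_Mβ_M > 0 and s := Σ_{j<M} α_jβ_j > 0. Let G be the symmetric M×M matrix with G[i,j] = −β_iβ_j B_j for i < j and G[m,m] = (β_m/α_m)(B_m Σ_{j<m} α_jβ_j + Σ_{j=m+1}^{M} α_jβ_j B_j). Then G[M,M] = (β_M/α_M) B_M s > 0, and the (M−1)×(M−1) Schur complement G' of the (M,M) entry, G'[i,j] = G[i,j] − G[i,M]G[M,j]/G[M,M], has the same structural form with updated parameters B'_m = B_m + (α_Mβ_M/s) B_M: namely G'[i,j] = −β_iβ_j B'_j for i < j ≤ M−1 and G'[m,m] = (β_m/α_m)(B'_m Σ_{j<m} α_jβ_j + Σ_{j=m+1}^{M−1} α_jβ_j B'_j), and B'_1 ≥ B'_2 ≥ … ≥ B'_{M−1} > 0. -/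
open Matrix BigOperators Finset

namespace Fin

variable {n : ℕ} {M : Type*} [AddCommMonoid M]

theorem sum_Iio_last (f : Fin (n + 1) → M) :
    ∑ k ∈ Finset.Iio (Fin.last n), f k = ∑ k : Fin n, f k.castSucc := by
  simp [← Finset.filter_gt_eq_Iio, Finset.sum_filter, Fin.sum_univ_castSucc, Fin.castSucc_lt_last]

theorem sum_Ioi_castSucc (f : Fin (n + 1) → M) (i : Fin n) :
    ∑ k ∈ Finset.Ioi i.castSucc, f k =
      ∑ k ∈ Finset.Ioi i, f k.castSucc + f (Fin.last n) := by
  simp [← Finset.filter_lt_eq_Ioi, Finset.sum_filter, Fin.sum_univ_castSucc, Fin.castSucc_lt_last]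

end Fin

theorem Finset.sum_Iio_add_add_sum_Ioi {ι M : Type*} [Fintype ι] [LinearOrder ι]
    [LocallyFiniteOrderBot ι] [LocallyFiniteOrderTop ι] [AddCommMonoid M] (f : ι → M) (i : ι) :
    ∑ k ∈ Finset.Iio i, f k + f i + ∑ k ∈ Finset.Ioi i, f k = ∑ k, f k := by
  rw [Finset.sum_Iio_add_eq_sum_Iic, ← Finset.filter_ge_eq_Iic, ← Finset.filter_lt_eq_Ioi]
  simpa only [not_le] using Finset.sum_filter_add_sum_filter_not Finset.univ (· ≤ i) f

/-- inductive step in the proof of Lemma 1: one step of symmetric Gaussian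
elimination (the Schur complement of the `(M,M)` entry) on the matrix `G = Σ_V` preserves
its structural form, with updated parameters `B'_m = B_m + (α_Mβ_M/s) B_M` which are again
decreasing and positive; moreover `G[M,M] = (β_M/α_M) B_M s > 0`. Here `M = n+1` and the
last index is `Fin.last n`. -/
theorem stmt_16 {n : ℕ} (hn : 1 ≤ n) (α β B : Fin (n + 1) → ℝ)
    (hα : ∀ m, α m ≠ 0)
    (hBmono : ∀ i j : Fin (n + 1), i ≤ j → B j ≤ B i) (hBpos : ∀ m, 0 < B m)
    (hlastpos : 0 < α (Fin.last n) * β (Fin.last n))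
    (s : ℝ) (hs : s = ∑ j ∈ Finset.Iio (Fin.last n), α j * β j) (hspos : 0 < s)
    (G : Matrix (Fin (n + 1)) (Fin (n + 1)) ℝ) (hG : G = SigmaV α β B)
    (G' : Matrix (Fin n) (Fin n) ℝ)
    (hG' : G' = Matrix.of fun i j =>
      G i.castSucc j.castSucc -
        G i.castSucc (Fin.last n) * G (Fin.last n) j.castSucc /
          G (Fin.last n) (Fin.last n))
    (B' : Fin n → ℝ)
    (hB' : B' = fun m =>
      B m.castSucc + (α (Fin.last n) * β (Fin.last n) / s) * B (Fin.last n)) :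
    G (Fin.last n) (Fin.last n) = (β (Fin.last n) / α (Fin.last n)) * (B (Fin.last n) * s) ∧
    0 < G (Fin.last n) (Fin.last n) ∧
    (∀ i j : Fin n, i < j → G' i j = -(β i.castSucc * β j.castSucc * B' j)) ∧
    (∀ m : Fin n, G' m m = (β m.castSucc / α m.castSucc) *
      (B' m * ∑ j ∈ Finset.Iio m, α j.castSucc * β j.castSucc +
        ∑ j ∈ Finset.Ioi m, α j.castSucc * β j.castSucc * B' j)) ∧
    (∀ i j : Fin n, i ≤ j → B' j ≤ B' i) ∧
    (∀ m, 0 < B' m) := by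
  have hlast : G (Fin.last n) (Fin.last n) =
      (β (Fin.last n) / α (Fin.last n)) * (B (Fin.last n) * s) := by
    have hIoi : Finset.Ioi (Fin.last n) = ∅ := by
      ext k
      simp [Fin.le_last]
    simp [hG, SigmaV, hs, hIoi]
  have hcol (i : Fin n) : G i.castSucc (Fin.last n) =
      -(β i.castSucc * β (Fin.last n) * B (Fin.last n)) := by
    simp [hG, SigmaV, (Fin.castSucc_lt_last i).ne, max_eq_right (Fin.castSucc_lt_last i).le]
  have hrow (i : Fin n) : G (Fin.last n) i.castSucc =
      -(β (Fin.last n) * β i.castSucc * B (Fin.last n)) := by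
    simp [hG, SigmaV, (Fin.castSucc_lt_last i).ne', max_eq_left (Fin.castSucc_lt_last i).le]
  have hα_last := hα (Fin.last n)
  have hβ_last : β (Fin.last n) ≠ 0 := right_ne_zero_of_mul hlastpos.ne'
  have hB_last := hBpos (Fin.last n)
  refine ⟨hlast, ?_, fun i j hij => ?_, fun m => ?_, fun i j hij => ?_, fun m => ?_⟩
  · rw [hlast]
    have hratio : 0 < β (Fin.last n) / α (Fin.last n) := by
      rw [div_pos_iff]
      rcases mul_pos_iff.mp hlastpos with h | h
      · exact Or.inl h.symm
      · exact Or.inr h.symm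
    positivity
  · have hentry : G i.castSucc j.castSucc = -(β i.castSucc * β j.castSucc * B j.castSucc) := by
      have h : i.castSucc < j.castSucc := Fin.castSucc_lt_castSucc_iff.mpr hij
      simp only [hG, SigmaV, Matrix.of_apply, if_neg h.ne, max_eq_right h.le]
    rw [hG', Matrix.of_apply, hentry, hcol, hrow, hlast, hB']
    have := hB_last.ne'
    field_simp
    ring
  · have hentry : G m.castSucc m.castSucc = (β m.castSucc / α m.castSucc) *
        (B m.castSucc * ∑ k ∈ Finset.Iio m, α k.castSucc * β k.castSucc +
          (∑ k ∈ Finset.Ioi m, α k.castSucc * β k.castSucc * B k.castSucc +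
            α (Fin.last n) * β (Fin.last n) * B (Fin.last n))) := by
      simp only [hG, SigmaV, Matrix.of_apply, if_true, Fin.sum_Iio_castSucc, Fin.sum_Ioi_castSucc]
    have hsplit : s = ∑ k ∈ Finset.Iio m, α k.castSucc * β k.castSucc +
        α m.castSucc * β m.castSucc + ∑ k ∈ Finset.Ioi m, α k.castSucc * β k.castSucc := by
      rw [hs, Fin.sum_Iio_last, Finset.sum_Iio_add_add_sum_Ioi fun k : Fin n =>
        α k.castSucc * β k.castSucc]
    have hIio : ∑ k ∈ Finset.Iio m, α k.castSucc * β k.castSucc =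
        s - α m.castSucc * β m.castSucc -
          ∑ k ∈ Finset.Ioi m, α k.castSucc * β k.castSucc := by
      linarith
    have := hB_last.ne'
    have := hα m.castSucc
    rw [hG', Matrix.of_apply, hentry, hcol, hrow, hlast, hB']
    simp only [mul_add, Finset.sum_add_distrib, ← Finset.sum_mul, hIio]
    field_simp
    ring
  · rw [hB']
    simpa using hBmono i.castSucc j.castSucc (Fin.castSucc_le_castSucc_iff.mpr hij)
  · rw [hB']
    have := hBpos m.castSucc
    positivity
end
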